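/- arXiv:math/0003037 — 2 statements merged into one kernel-verified Lean document; each statement's English description precedes it below -/
import Mathlib

section
/- Suppose f'' ≤ 0 on (a,b) (equivalently, the timelike convergence condition Ric(∂_τ, ∂_τ) ≥ 0 holds for g^f) and M is inextendible. Then M is geodesically connected. -/
open Set Filter MeasureTheory Topology
open scoped ENNReal NNReal

noncomputable section

namespace GRW

/-- The open interval `(a,b)` (extended-real endpoints) as a subset of `ℝ`. -/
def II (aE bE : EReal) : Set ℝ := {τ : ℝ | aE < (τ : EReal) ∧ (τ : EReal) < bE}

/-- `G = 1/f²`. -/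
def G (f : ℝ → ℝ) (τ : ℝ) : ℝ := ((f τ) ^ 2)⁻¹

/-- The nonnegative integrand `f⁻² (G − D)^{-1/2}`, valued in `[0,∞]`. -/
def h (f : ℝ → ℝ) (D τ : ℝ) : ℝ≥0∞ :=
  ENNReal.ofReal ((f τ ^ 2 * Real.sqrt (G f τ - D))⁻¹)

/-- A geodesic `t ↦ (σ t, x t)` of `g^f = -dτ² + f(τ)² dx²` defined on `[t0, t1]`,
with values in the spacetime `(a,b) × J`. -/
structure IsGeodesicOn (aE bE : EReal) (f : ℝ → ℝ) (J : Set ℝ)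
    (σ x : ℝ → ℝ) (t0 t1 : ℝ) : Prop where
  mem_base : ∀ t ∈ Icc t0 t1, σ t ∈ II aE bE
  mem_fiber : ∀ t ∈ Icc t0 t1, x t ∈ J
  smooth_base : ContDiffOn ℝ 2 σ (Icc t0 t1)
  smooth_fiber : ContDiffOn ℝ 2 x (Icc t0 t1)
  eq_base : ∀ t ∈ Icc t0 t1,
    derivWithin (derivWithin σ (Icc t0 t1)) (Icc t0 t1) t
      = -(f (σ t) * deriv f (σ t) * (derivWithin x (Icc t0 t1) t) ^ 2)
  eq_fiber : ∀ t ∈ Icc t0 t1,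
    derivWithin (derivWithin x (Icc t0 t1)) (Icc t0 t1) t
      = -(2 * (deriv f (σ t) / f (σ t)) * derivWithin σ (Icc t0 t1) t
          * derivWithin x (Icc t0 t1) t)

/-- The energy `-(τ')² + f(τ)² (x')²` of a curve `(σ, x)` parameterized on `[t0,t1]`. -/
def energyW (f σ x : ℝ → ℝ) (t0 t1 t : ℝ) : ℝ :=
  -(derivWithin σ (Icc t0 t1) t) ^ 2 + (f (σ t)) ^ 2 * (derivWithin x (Icc t0 t1) t) ^ 2

/-- The velocity of a curve `(σ, x)` parameterized on `[t0,t1]`. -/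
def velW (σ x : ℝ → ℝ) (t0 t1 t : ℝ) : ℝ × ℝ :=
  (derivWithin σ (Icc t0 t1) t, derivWithin x (Icc t0 t1) t)

/-- Geodesic connectedness of the GRW spacetime `(a,b) × J`. -/
def GeodConnected (aE bE : EReal) (f : ℝ → ℝ) (J : Set ℝ) : Prop :=
  ∀ τ0 x0 τ0' x0' : ℝ, τ0 ∈ II aE bE → x0 ∈ J → τ0' ∈ II aE bE → x0' ∈ J →
    ∃ (σ x : ℝ → ℝ) (t1 : ℝ), 0 ≤ t1 ∧ IsGeodesicOn aE bE f J σ x 0 t1 ∧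
      σ 0 = τ0 ∧ x 0 = x0 ∧ σ t1 = τ0' ∧ x t1 = x0'

/-- Two points are related by a piecewise-`C¹` curve in the spacetime all of whose pieces
satisfy the pointwise condition `P` on (energy density, velocity). -/
def RelatedVia (aE bE : EReal) (f : ℝ → ℝ) (J : Set ℝ)
    (P : ℝ → ℝ × ℝ → Prop) (z z' : ℝ × ℝ) : Prop :=
  ∃ (n : ℕ) (s : ℕ → ℝ) (σ x : ℝ → ℝ),
    s 0 = 0 ∧ s (n + 1) = 1 ∧ (∀ i ≤ n, s i < s (i + 1)) ∧
    σ 0 = z.1 ∧ x 0 = z.2 ∧ σ 1 = z'.1 ∧ x 1 = z'.2 ∧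
    (∀ t ∈ Icc (0:ℝ) 1, σ t ∈ II aE bE ∧ x t ∈ J) ∧
    ContinuousOn σ (Icc 0 1) ∧ ContinuousOn x (Icc 0 1) ∧
    ∀ i ≤ n, ContDiffOn ℝ 1 σ (Icc (s i) (s (i + 1))) ∧
      ContDiffOn ℝ 1 x (Icc (s i) (s (i + 1))) ∧
      ∀ t ∈ Icc (s i) (s (i + 1)),
        P (energyW f σ x (s i) (s (i + 1)) t) (velW σ x (s i) (s (i + 1)) t)

/-- Timelike related: joined by a piecewise smooth timelike curve. -/
def TimelikeRel (aE bE : EReal) (f : ℝ → ℝ) (J : Set ℝ) (z z' : ℝ × ℝ) : Prop :=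
  RelatedVia aE bE f J (fun q _ => q < 0) z z'

/-- Spacelike related: joined by a piecewise smooth spacelike curve. -/
def SpacelikeRel (aE bE : EReal) (f : ℝ → ℝ) (J : Set ℝ) (z z' : ℝ × ℝ) : Prop :=
  RelatedVia aE bE f J (fun q _ => 0 < q) z z'

/-- Lightlike related: joined by a piecewise smooth lightlike curve with
nowhere-vanishing velocity. -/
def LightlikeRel (aE bE : EReal) (f : ℝ → ℝ) (J : Set ℝ) (z z' : ℝ × ℝ) : Prop :=
  RelatedVia aE bE f J (fun q v => q = 0 ∧ v ≠ 0) z z'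

/-- The filter of approach to `b` from inside `(a,b)`. -/
def Fb (bE : EReal) : Filter ℝ := comap (fun τ : ℝ => (τ : EReal)) (𝓝[<] bE)

/-- The filter of approach to `a` from inside `(a,b)`. -/
def Fa (aE : EReal) : Filter ℝ := comap (fun τ : ℝ => (τ : EReal)) (𝓝[>] aE)

/-- `m_b = liminf_{τ→b} G(τ)`, valued in `EReal`. -/
def mB (bE : EReal) (f : ℝ → ℝ) : EReal := liminf (fun τ => (G f τ : EReal)) (Fb bE)

/-- `m_a = liminf_{τ→a} G(τ)`, valued in `EReal`. -/
def mA (aE : EReal) (f : ℝ → ℝ) : EReal := liminf (fun τ => (G f τ : EReal)) (Fa aE)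

/-- `c` witnesses that `G` reaches a relative minimum at `b`: `G > m_b` on `(c,b)`. -/
def RelMinB (aE bE : EReal) (f : ℝ → ℝ) (c : ℝ) : Prop :=
  c ∈ II aE bE ∧ ∀ τ : ℝ, c < τ → (τ : EReal) < bE → mB bE f < (G f τ : EReal)

/-- `c` witnesses that `G` reaches a relative minimum at `a`: `G > m_a` on `(a,c)`. -/
def RelMinA (aE bE : EReal) (f : ℝ → ℝ) (c : ℝ) : Prop :=
  c ∈ II aE bE ∧ ∀ τ : ℝ, τ < c → aE < (τ : EReal) → mA aE f < (G f τ : EReal)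

/-- `∫_c^b f⁻²(G−D)^{-1/2}`, valued in `[0,∞]`. -/
def IbInt (bE : EReal) (f : ℝ → ℝ) (c D : ℝ) : ℝ≥0∞ :=
  ∫⁻ τ in {τ : ℝ | c < τ ∧ (τ : EReal) < bE}, h f D τ

/-- `∫_a^c f⁻²(G−D)^{-1/2}`, valued in `[0,∞]`. -/
def IaInt (aE : EReal) (f : ℝ → ℝ) (c D : ℝ) : ℝ≥0∞ :=
  ∫⁻ τ in {τ : ℝ | aE < (τ : EReal) ∧ τ < c}, h f D τ

/-- Condition (A) at `b`. -/
def CondA_b (aE bE : EReal) (f : ℝ → ℝ) : Prop :=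
  (¬ ∃ c, RelMinB aE bE f c) ∨
  ∃ c, RelMinB aE bE f c ∧ IbInt bE f c (mB bE f).toReal = ⊤

/-- Condition (A) at `a`. -/
def CondA_a (aE bE : EReal) (f : ℝ → ℝ) : Prop :=
  (¬ ∃ c, RelMinA aE bE f c) ∨
  ∃ c, RelMinA aE bE f c ∧ IaInt aE f c (mA aE f).toReal = ⊤

/-- Condition (A). -/
def CondA (aE bE : EReal) (f : ℝ → ℝ) : Prop :=
  CondA_a aE bE f ∧ CondA_b aE bE f

/-- `b^*(D) = inf {τ ∈ (c,b) | G τ = D}`, defaulting to `b` when the set is empty. -/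
def bstar (bE : EReal) (f : ℝ → ℝ) (c D : ℝ) : EReal :=
  sInf (insert bE ((fun τ : ℝ => (τ : EReal)) ''
    {τ : ℝ | c < τ ∧ (τ : EReal) < bE ∧ G f τ = D}))

/-- `a^*(D) = sup {τ ∈ (a,c) | G τ = D}`, defaulting to `a` when the set is empty. -/
def astar (aE : EReal) (f : ℝ → ℝ) (c D : ℝ) : EReal :=
  sSup (insert aE ((fun τ : ℝ => (τ : EReal)) ''
    {τ : ℝ | τ < c ∧ aE < (τ : EReal) ∧ G f τ = D}))

/-- `∫_c^{b^*(D)} f⁻²(G−D)^{-1/2}`. -/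
def IbStar (bE : EReal) (f : ℝ → ℝ) (c D : ℝ) : ℝ≥0∞ :=
  ∫⁻ τ in {τ : ℝ | c < τ ∧ (τ : EReal) < bstar bE f c D}, h f D τ

/-- `∫_{a^*(D)}^c f⁻²(G−D)^{-1/2}`. -/
def IaStar (aE : EReal) (f : ℝ → ℝ) (c D : ℝ) : ℝ≥0∞ :=
  ∫⁻ τ in {τ : ℝ | astar aE f c D < (τ : EReal) ∧ τ < c}, h f D τ

/-- `d_b`, computed with respect to the cut point `c`. -/
def dB (bE : EReal) (f : ℝ → ℝ) (c : ℝ) : ℝ≥0∞ :=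
  limsup (fun D => IbStar bE f c D) (𝓝[>] (mB bE f).toReal) - IbInt bE f c (mB bE f).toReal

/-- `d_a`, computed with respect to the cut point `c`. -/
def dA (aE : EReal) (f : ℝ → ℝ) (c : ℝ) : ℝ≥0∞ :=
  limsup (fun D => IaStar aE f c D) (𝓝[>] (mA aE f).toReal) - IaInt aE f c (mA aE f).toReal

/-- Condition (B) at `b`. -/
def CondB_b (aE bE : EReal) (f : ℝ → ℝ) (J : Set ℝ) : Prop :=
  CondA_b aE bE f ∨ ∃ c, RelMinB aE bE f c ∧ EMetric.diam J ≤ 2 * dB bE f c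

/-- Condition (B) at `a`. -/
def CondB_a (aE bE : EReal) (f : ℝ → ℝ) (J : Set ℝ) : Prop :=
  CondA_a aE bE f ∨ ∃ c, RelMinA aE bE f c ∧ EMetric.diam J ≤ 2 * dA aE f c

/-- Condition (B). -/
def CondB (aE bE : EReal) (f : ℝ → ℝ) (J : Set ℝ) : Prop :=
  CondB_a aE bE f J ∧ CondB_b aE bE f J

/-- `m = inf_{(a,b)} G`. -/
def mGlob (aE bE : EReal) (f : ℝ → ℝ) : ℝ := sInf (G f '' II aE bE)

/-- `α(D) = sup {τ ∈ (a,b) | G τ = D}`. -/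
def alphaD (aE bE : EReal) (f : ℝ → ℝ) (D : ℝ) : EReal :=
  sSup ((fun τ : ℝ => (τ : EReal)) '' {τ : ℝ | τ ∈ II aE bE ∧ G f τ = D})

/-- `β(D) = inf {τ ∈ (a,b) | G τ = D}`. -/
def betaD (aE bE : EReal) (f : ℝ → ℝ) (D : ℝ) : EReal :=
  sInf ((fun τ : ℝ => (τ : EReal)) '' {τ : ℝ | τ ∈ II aE bE ∧ G f τ = D})

/-- `i_b = inf_{D ∈ (m, m_b)} ∫_{α(D)}^b f⁻²(G−D)^{-1/2}`. -/
def iB (aE bE : EReal) (f : ℝ → ℝ) : ℝ≥0∞ :=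
  ⨅ D ∈ Ioo (mGlob aE bE f) (mB bE f).toReal,
    ∫⁻ τ in {τ : ℝ | alphaD aE bE f D < (τ : EReal) ∧ (τ : EReal) < bE}, h f D τ

/-- `i_a = inf_{D ∈ (m, m_a)} ∫_a^{β(D)} f⁻²(G−D)^{-1/2}`. -/
def iA (aE bE : EReal) (f : ℝ → ℝ) : ℝ≥0∞ :=
  ⨅ D ∈ Ioo (mGlob aE bE f) (mA aE f).toReal,
    ∫⁻ τ in {τ : ℝ | aE < (τ : EReal) ∧ (τ : EReal) < betaD aE bE f D}, h f D τ

/-- Condition (C) at `b`. -/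
def CondC_b (aE bE : EReal) (f : ℝ → ℝ) (J : Set ℝ) : Prop :=
  CondB_b aE bE f J ∨
    ((mGlob aE bE f : EReal) < mB bE f ∧ ∃ c, RelMinB aE bE f c ∧ iB aE bE f ≤ dB bE f c)

/-- Condition (C) at `a`. -/
def CondC_a (aE bE : EReal) (f : ℝ → ℝ) (J : Set ℝ) : Prop :=
  CondB_a aE bE f J ∨
    ((mGlob aE bE f : EReal) < mA aE f ∧ ∃ c, RelMinA aE bE f c ∧ iA aE bE f ≤ dA aE f c)

/-- Condition (C). -/
def CondC (aE bE : EReal) (f : ℝ → ℝ) (J : Set ℝ) : Prop :=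
  CondC_a aE bE f J ∧ CondC_b aE bE f J

/-! ### Condition (R) -/

/-- `b^*(D) = inf {τ ∈ [τ0, b) | G τ = D}` (defaulting to `b`). -/
def bstarR (bE : EReal) (f : ℝ → ℝ) (τ0 D : ℝ) : EReal :=
  sInf (insert bE ((fun τ : ℝ => (τ : EReal)) ''
    {τ : ℝ | τ0 ≤ τ ∧ (τ : EReal) < bE ∧ G f τ = D}))

/-- `a^*(D) = sup {τ ∈ (a, τ0] | G τ = D}` (defaulting to `a`). -/
def astarR (aE : EReal) (f : ℝ → ℝ) (τ0 D : ℝ) : EReal :=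
  sSup (insert aE ((fun τ : ℝ => (τ : EReal)) ''
    {τ : ℝ | τ ≤ τ0 ∧ aE < (τ : EReal) ∧ G f τ = D}))

/-- `A(D) = ∫_{a^*(D)}^{τ0} h_D`. -/
def AInt (aE : EReal) (f : ℝ → ℝ) (τ0 D : ℝ) : ℝ≥0∞ :=
  ∫⁻ τ in {τ : ℝ | astarR aE f τ0 D < (τ : EReal) ∧ τ < τ0}, h f D τ

/-- `B(D) = ∫_{τ0}^{b^*(D)} h_D`. -/
def BInt (bE : EReal) (f : ℝ → ℝ) (τ0 D : ℝ) : ℝ≥0∞ :=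
  ∫⁻ τ in {τ : ℝ | τ0 < τ ∧ (τ : EReal) < bstarR bE f τ0 D}, h f D τ

/-- `T(D) = ∫_{a^*(D)}^{b^*(D)} h_D`. -/
def TInt (aE bE : EReal) (f : ℝ → ℝ) (τ0 D : ℝ) : ℝ≥0∞ :=
  ∫⁻ τ in {τ : ℝ | astarR aE f τ0 D < (τ : EReal) ∧ (τ : EReal) < bstarR bE f τ0 D},
    h f D τ

/-- The point `b − ε` (replaced by `1/ε` when `b = ∞`). -/
def bEnd (bE : EReal) (ε : ℝ) : ℝ := if bE = ⊤ then ε⁻¹ else bE.toReal - ε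

/-- The point `a + ε` (replaced by `−1/ε` when `a = −∞`). -/
def aEnd (aE : EReal) (ε : ℝ) : ℝ := if aE = ⊥ then -ε⁻¹ else aE.toReal + ε

/-- The oriented integral `Q(D,ε) = ∫_{b−ε}^{b^*(D)} h_D`, valued in `[−∞,∞]`. -/
def QInt (bE : EReal) (f : ℝ → ℝ) (τ0 D ε : ℝ) : EReal :=
  if ((bEnd bE ε : ℝ) : EReal) ≤ bstarR bE f τ0 D then
    ((∫⁻ τ in {τ : ℝ | bEnd bE ε < τ ∧ (τ : EReal) < bstarR bE f τ0 D}, h f D τ : ℝ≥0∞) :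
      EReal)
  else
    -((∫⁻ τ in {τ : ℝ | bstarR bE f τ0 D < (τ : EReal) ∧ τ < bEnd bE ε}, h f D τ : ℝ≥0∞) :
      EReal)

/-- The oriented integral `Q'(D,ε) = ∫_{a^*(D)}^{a+ε} h_D`, valued in `[−∞,∞]`. -/
def QInt' (aE : EReal) (f : ℝ → ℝ) (τ0 D ε : ℝ) : EReal :=
  if astarR aE f τ0 D ≤ ((aEnd aE ε : ℝ) : EReal) then
    ((∫⁻ τ in {τ : ℝ | astarR aE f τ0 D < (τ : EReal) ∧ τ < aEnd aE ε}, h f D τ : ℝ≥0∞) :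
      EReal)
  else
    -((∫⁻ τ in {τ : ℝ | aEnd aE ε < τ ∧ (τ : EReal) < astarR aE f τ0 D}, h f D τ : ℝ≥0∞) :
      EReal)

/-- `C_n(D)`: `B(D)` for even `n`, `A(D)` for odd `n`. -/
def CInt (aE bE : EReal) (f : ℝ → ℝ) (τ0 : ℝ) (n : ℕ) (D : ℝ) : ℝ≥0∞ :=
  if Even n then BInt bE f τ0 D else AInt aE f τ0 D

/-- `C'_n(D)`: `A(D)` for even `n`, `B(D)` for odd `n`. -/
def CInt' (aE bE : EReal) (f : ℝ → ℝ) (τ0 : ℝ) (n : ℕ) (D : ℝ) : ℝ≥0∞ :=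
  if Even n then AInt aE f τ0 D else BInt bE f τ0 D

/-- `r_i^n(τ0) = lim_{ε↘0} liminf_{D↘m} (C_n(D) + n·T(D) − Q(D,ε))`; since the inner
quantity is nonincreasing in `ε`, the limit as `ε ↘ 0` is the supremum over `ε > 0`. -/
def rI (aE bE : EReal) (f : ℝ → ℝ) (τ0 : ℝ) (n : ℕ) : EReal :=
  ⨆ ε : {e : ℝ // 0 < e},
    liminf (fun D =>
        ((CInt aE bE f τ0 n D + n * TInt aE bE f τ0 D : ℝ≥0∞) : EReal)
          - QInt bE f τ0 D ε.1)
      (𝓝[>] (mGlob aE bE f))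

/-- `r_s^n(τ0) = lim_{ε↘0} limsup_{D↘m} (C_n(D) + n·T(D) + Q(D,ε))`. -/
def rS (aE bE : EReal) (f : ℝ → ℝ) (τ0 : ℝ) (n : ℕ) : EReal :=
  ⨅ ε : {e : ℝ // 0 < e},
    limsup (fun D =>
        ((CInt aE bE f τ0 n D + n * TInt aE bE f τ0 D : ℝ≥0∞) : EReal)
          + QInt bE f τ0 D ε.1)
      (𝓝[>] (mGlob aE bE f))

/-- `l_i^n(τ0) = lim_{ε↘0} liminf_{D↘m} (C'_n(D) + n·T(D) − Q'(D,ε))`. -/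
def lI (aE bE : EReal) (f : ℝ → ℝ) (τ0 : ℝ) (n : ℕ) : EReal :=
  ⨆ ε : {e : ℝ // 0 < e},
    liminf (fun D =>
        ((CInt' aE bE f τ0 n D + n * TInt aE bE f τ0 D : ℝ≥0∞) : EReal)
          - QInt' aE f τ0 D ε.1)
      (𝓝[>] (mGlob aE bE f))

/-- `l_s^n(τ0) = lim_{ε↘0} limsup_{D↘m} (C'_n(D) + n·T(D) + Q'(D,ε))`. -/
def lS (aE bE : EReal) (f : ℝ → ℝ) (τ0 : ℝ) (n : ℕ) : EReal :=
  ⨅ ε : {e : ℝ // 0 < e},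
    limsup (fun D =>
        ((CInt' aE bE f τ0 n D + n * TInt aE bE f τ0 D : ℝ≥0∞) : EReal)
          + QInt' aE f τ0 D ε.1)
      (𝓝[>] (mGlob aE bE f))

/-- Condition (R). -/
def CondR (aE bE : EReal) (f : ℝ → ℝ) (J : Set ℝ) : Prop :=
  (∀ τ ∈ II aE bE, mGlob aE bE f < G f τ) ∧
  mA aE f = (mGlob aE bE f : EReal) ∧ mB bE f = (mGlob aE bE f : EReal) ∧
  ∀ τ0 ∈ II aE bE,
    (Icc (rI aE bE f τ0 0) ((EMetric.diam J : ℝ≥0∞) : EReal) ⊆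
        ⋃ n : ℕ, Icc (rI aE bE f τ0 n) (rS aE bE f τ0 n)) ∧
    (Icc (lI aE bE f τ0 0) ((EMetric.diam J : ℝ≥0∞) : EReal) ⊆
        ⋃ n : ℕ, Icc (lI aE bE f τ0 n) (lS aE bE f τ0 n))

end GRW


lemma aux_diffeo (g : ℝ → ℝ) (hg : Continuous g) (ε : ℝ) (hε : 0 < ε) (h : ∀ y, ε ≤ g y) (c : ℝ) :
    ∃ φ ψ : ℝ → ℝ, φ c = 0 ∧ (∀ y, HasDerivAt φ (g y) y) ∧ StrictMono φ ∧ (∀ y, ψ (φ y) = y) ∧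
      (∀ u, φ (ψ u) = u) ∧ ∀ u, HasDerivAt ψ (g (ψ u))⁻¹ u := by
  let φ : ℝ → ℝ := fun u => ∫ x in c..u, g x
  have hφ : ∀ y, HasDerivAt φ (g y) y := fun y => (hg.integral_hasStrictDerivAt c y).hasDerivAt
  have hφc : Continuous φ := continuous_iff_continuousAt.2 fun y => (hφ y).continuousAt
  have hmono : StrictMono φ := by
    apply strictMono_of_deriv_pos
    intro y
    rw [(hφ y).deriv]
    exact hε.trans_le (h y)
  have hm2 : Monotone (fun y => φ y - ε * y) := by
    have hd : ∀ y, HasDerivAt (fun y => φ y - ε * y) (g y - ε * 1) y := fun y =>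
      (hφ y).sub ((hasDerivAt_id y).const_mul ε)
    apply monotone_of_deriv_nonneg (fun y => (hd y).differentiableAt)
    intro y
    rw [(hd y).deriv]
    linarith [h y]
  have htop : Tendsto φ atTop atTop := by
    have h1 : Tendsto (fun y : ℝ => ε * y + (φ 0)) atTop atTop :=
      tendsto_atTop_add_const_right _ _ (tendsto_id.const_mul_atTop hε)
    refine tendsto_atTop_mono' _ ?_ h1
    filter_upwards [eventually_ge_atTop 0] with y hy
    have := hm2 hy
    simp at this
    linarith
  have hbot : Tendsto φ atBot atBot := by
    have h1 : Tendsto (fun y : ℝ => ε * y + (φ 0)) atBot atBot :=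
      tendsto_atBot_add_const_right _ _ (tendsto_id.const_mul_atBot hε)
    refine tendsto_atBot_mono' _ ?_ h1
    filter_upwards [eventually_le_atBot 0] with y hy
    have := hm2 hy
    simp at this
    linarith
  have hsurj : Function.Surjective φ := hφc.surjective htop hbot
  let e := hmono.orderIsoOfSurjective φ hsurj
  have he1 : ∀ y, e.symm (φ y) = y := fun y => e.symm_apply_apply y
  have he2 : ∀ u, φ (e.symm u) = u := fun u => e.apply_symm_apply u
  refine ⟨φ, e.symm, by simp [φ], hφ, hmono, he1, he2, fun u => ?_⟩
  exact HasDerivAt.of_local_left_inverse e.symm.continuous.continuousAt (hφ _)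
    (hε.trans_le (h _)).ne' (Eventually.of_forall he2)

lemma aux_max (L : ℝ) (w w1 w2 : ℝ → ℝ) (hc : ContinuousOn w (Icc 0 L))
    (h1 : ∀ x ∈ Ioo 0 L, HasDerivAt w (w1 x) x) (h2 : ∀ x ∈ Ioo 0 L, HasDerivAt w1 (w2 x) x)
    (hpos : ∀ x ∈ Ioo 0 L, 0 < w x → 0 ≤ w2 x) (h0 : w 0 ≤ 0) (hL : w L ≤ 0) :
    ∀ x ∈ Icc 0 L, w x ≤ 0 := by
  intro x hx
  by_contra! hwx
  obtain ⟨ξ, hξ, hmax⟩ := isCompact_Icc.exists_isMaxOn ⟨x, hx⟩ hc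
  have hξpos : 0 < w ξ := hwx.trans_le (hmax hx)
  have hξ' : ξ ∈ Ioo 0 L := by
    constructor
    · rcases hξ.1.lt_or_eq with h | h
      · exact h
      · subst h; linarith
    · rcases hξ.2.lt_or_eq with h | h
      · exact h
      · subst h; linarith
  have hd0 : w1 ξ = 0 := by
    have : IsLocalMax w ξ := hmax.isLocalMax (Icc_mem_nhds hξ'.1 hξ'.2)
    exact this.hasDerivAt_eq_zero (h1 ξ hξ')
  have hsub : Icc ξ L ⊆ Icc 0 L := Icc_subset_Icc hξ.1 le_rfl
  have hcomp : IsCompact (Icc ξ L ∩ w ⁻¹' Iic 0) :=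
    isCompact_Icc.of_isClosed_subset
      ((hc.mono hsub).preimage_isClosed_of_isClosed isClosed_Icc isClosed_Iic) inter_subset_left
  obtain ⟨s, ⟨hs, hs0⟩, hleast⟩ := hcomp.exists_isLeast ⟨L, ⟨hξ.2, le_rfl⟩, hL⟩
  have hs0 : w s ≤ 0 := hs0
  have hwpos : ∀ y ∈ Ico ξ s, 0 < w y := by
    intro y hy
    by_contra! hn
    have := hleast ⟨⟨hy.1, hy.2.le.trans hs.2⟩, hn⟩
    linarith [hy.2]
  have hin : ∀ y ∈ Ico ξ s, y ∈ Ioo 0 L := fun y hy => ⟨hξ'.1.trans_le hy.1, hy.2.trans_le hs.2⟩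
  have hm1 : MonotoneOn w1 (Ico ξ s) := by
    apply monotoneOn_of_deriv_nonneg (convex_Ico _ _)
    · intro y hy; exact (h2 y (hin y hy)).continuousAt.continuousWithinAt
    · intro y hy; rw [interior_Ico] at hy
      exact (h2 y (hin y ⟨hy.1.le, hy.2⟩)).differentiableAt.differentiableWithinAt
    · intro y hy; rw [interior_Ico] at hy
      have hy' : y ∈ Ico ξ s := ⟨hy.1.le, hy.2⟩
      rw [(h2 y (hin y hy')).deriv]
      exact hpos y (hin y hy') (hwpos y hy')
  have hm : MonotoneOn w (Icc ξ s) := by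
    apply monotoneOn_of_deriv_nonneg (convex_Icc _ _)
    · exact hc.mono (Icc_subset_Icc hξ.1 hs.2)
    · intro y hy; rw [interior_Icc] at hy
      exact (h1 y (hin y ⟨hy.1.le, hy.2⟩)).differentiableAt.differentiableWithinAt
    · intro y hy; rw [interior_Icc] at hy
      have hy' : y ∈ Ico ξ s := ⟨hy.1.le, hy.2⟩
      rw [(h1 y (hin y hy')).deriv, ← hd0]
      exact hm1 ⟨le_rfl, hy.1.trans hy.2⟩ hy' hy.1.le
  have := hm ⟨le_rfl, hs.1⟩ ⟨hs.1, le_rfl⟩ hs.1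
  linarith

lemma aux_C2 (T : ℝ) (hT : 0 < T) (y y1 y2 : ℝ → ℝ)
    (h1 : ∀ t ∈ Icc 0 T, HasDerivWithinAt y (y1 t) (Icc 0 T) t)
    (h2 : ∀ t ∈ Icc 0 T, HasDerivWithinAt y1 (y2 t) (Icc 0 T) t)
    (hc : ContinuousOn y2 (Icc 0 T)) :
    ContDiffOn ℝ 2 y (Icc 0 T) ∧ (∀ t ∈ Icc 0 T, derivWithin y (Icc 0 T) t = y1 t) ∧
      ∀ t ∈ Icc 0 T, derivWithin (derivWithin y (Icc 0 T)) (Icc 0 T) t = y2 t := by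
  have hu : UniqueDiffOn ℝ (Icc 0 T) := uniqueDiffOn_Icc hT
  have e1 : ∀ t ∈ Icc 0 T, derivWithin y (Icc 0 T) t = y1 t := fun t ht =>
    (h1 t ht).derivWithin (hu t ht)
  have e1' : ∀ t ∈ Icc 0 T, derivWithin y1 (Icc 0 T) t = y2 t := fun t ht =>
    (h2 t ht).derivWithin (hu t ht)
  have e2 : ∀ t ∈ Icc 0 T, derivWithin (derivWithin y (Icc 0 T)) (Icc 0 T) t = y2 t := by
    intro t ht
    rw [derivWithin_congr e1 (e1 t ht), e1' t ht]
  refine ⟨?_, e1, e2⟩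
  have c1 : ContDiffOn ℝ 1 y1 (Icc 0 T) := by
    rw [show (1 : WithTop ℕ∞) = 0 + 1 by norm_num, contDiffOn_succ_iff_derivWithin hu]
    refine ⟨fun t ht => (h2 t ht).differentiableWithinAt, by simp, ?_⟩
    rw [contDiffOn_zero]
    exact hc.congr e1'
  rw [show (2 : WithTop ℕ∞) = 1 + 1 by norm_num, contDiffOn_succ_iff_derivWithin hu]
  exact ⟨fun t ht => (h1 t ht).differentiableWithinAt, by simp, c1.congr e1⟩


lemma aux_bvp (F : ℝ → ℝ) (K : ℝ≥0) (hF : LipschitzWith K F) (B : ℝ) (hB : ∀ u, |F u| ≤ B)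
    (L : ℝ) (hL : 0 < L) (u0 u1 : ℝ) :
    ∃ u v : ℝ → ℝ, (∀ x ∈ Icc 0 L, HasDerivWithinAt u (v x) (Icc 0 L) x) ∧
      (∀ x ∈ Icc 0 L, HasDerivWithinAt v (F (u x)) (Icc 0 L) x) ∧ u 0 = u0 ∧ u L = u1 := by
  have hB0 : 0 ≤ B := (abs_nonneg _).trans (hB 0)
  set r : ℝ := |u1 - u0| / L + B * L with hr
  have hr0 : 0 ≤ r := by positivity
  set V : ℝ := r + B * L with hV
  have hV0 : 0 ≤ V := by positivity
  have hVV : -V ≤ V := by linarith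
  let X : ℝ × ℝ → ℝ × ℝ := fun z => ((projIcc (-V) V hVV z.2 : ℝ), F z.1)
  have hXl : LipschitzWith (max (1 * 1 * 1) (K * 1)) X :=
    ((LipschitzWith.subtype_val _).comp (LipschitzWith.projIcc hVV) |>.comp
      LipschitzWith.prod_snd).prodMk (hF.comp LipschitzWith.prod_fst)
  have hXb : ∀ z, ‖X z‖ ≤ V + B := by
    intro z
    rw [Prod.norm_def]
    apply max_le
    · have := (projIcc (-V) V hVV z.2).2
      rw [Real.norm_eq_abs]
      have h2 : |(projIcc (-V) V hVV z.2 : ℝ)| ≤ V := abs_le.2 this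
      change |(projIcc (-V) V hVV z.2 : ℝ)| ≤ V + B
      linarith
    · have := hB z.1
      change |F z.1| ≤ V + B
      linarith
  have h0m : (0 : ℝ) ∈ Icc 0 L := ⟨le_rfl, hL.le⟩
  have hLm : L ∈ Icc 0 L := ⟨hL.le, le_rfl⟩
  have hPL : IsPicardLindelof (fun _ => X) (tmin := 0) (tmax := L) ⟨0, h0m⟩ (u0, (0 : ℝ))
      (⟨r + (V + B) * L, by positivity⟩ : ℝ≥0) (⟨r, hr0⟩ : ℝ≥0) (⟨V + B, by positivity⟩ : ℝ≥0)
      (max (1 * 1 * 1) (K * 1)) := by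
    apply IsPicardLindelof.of_time_independent
    · intro z _; exact hXb z
    · exact hXl.lipschitzOnWith
    · change (V + B) * max (L - 0) (0 - 0) ≤ (r + (V + B) * L) - r
      simp [max_eq_left hL.le]
  obtain ⟨α, hα, hαc⟩ := hPL.exists_forall_mem_closedBall_eq_hasDerivWithinAt_continuousOn
  have hball : ∀ p ∈ Icc (-r) r, ((u0, p) : ℝ × ℝ) ∈ Metric.closedBall ((u0, (0 : ℝ)) : ℝ × ℝ)
      ((⟨r, hr0⟩ : ℝ≥0) : ℝ) := by
    intro p hp
    rw [Metric.mem_closedBall, Prod.dist_eq]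
    simp only [dist_self, Real.dist_eq, sub_zero]
    exact max_le hr0 (abs_le.2 hp)
  let U : ℝ → ℝ → ℝ := fun p x => (α ((u0, p), x)).1
  let W : ℝ → ℝ → ℝ := fun p x => (α ((u0, p), x)).2
  have hU0 : ∀ p ∈ Icc (-r) r, U p 0 = u0 := fun p hp => by
    have := (hα _ (hball p hp)).1
    exact congrArg Prod.fst this
  have hW0 : ∀ p ∈ Icc (-r) r, W p 0 = p := fun p hp => by
    have := (hα _ (hball p hp)).1
    exact congrArg Prod.snd this
  have hW : ∀ p ∈ Icc (-r) r, ∀ x ∈ Icc 0 L,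
      HasDerivWithinAt (W p) (F (U p x)) (Icc 0 L) x := fun p hp x hx => by
    have := (hα _ (hball p hp)).2 x hx
    exact (hasFDerivAt_snd.comp_hasDerivWithinAt x this :)
  have hU' : ∀ p ∈ Icc (-r) r, ∀ x ∈ Icc 0 L,
      HasDerivWithinAt (U p) (projIcc (-V) V hVV (W p x) : ℝ) (Icc 0 L) x := fun p hp x hx => by
    have := (hα _ (hball p hp)).2 x hx
    exact (hasFDerivAt_fst.comp_hasDerivWithinAt x this :)
  have hWp : ∀ p ∈ Icc (-r) r, ∀ x ∈ Icc 0 L, |W p x - p| ≤ B * L := by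
    intro p hp x hx
    have := (convex_Icc 0 L).norm_image_sub_le_of_norm_hasDerivWithin_le (C := B)
      (hW p hp) (fun x hx => hB _) h0m hx
    rw [hW0 p hp, Real.norm_eq_abs, Real.norm_eq_abs, sub_zero, abs_of_nonneg hx.1] at this
    exact this.trans (mul_le_mul_of_nonneg_left hx.2 hB0)
  have hU : ∀ p ∈ Icc (-r) r, ∀ x ∈ Icc 0 L, HasDerivWithinAt (U p) (W p x) (Icc 0 L) x := by
    intro p hp x hx
    have h1 := hU' p hp x hx
    have h2 := abs_le.1 (hWp p hp x hx)
    rwa [projIcc_of_mem hVV (show W p x ∈ Icc (-V) V from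
      ⟨by linarith [hp.1, hp.2], by linarith [hp.1, hp.2]⟩)] at h1
  have hUL : ∀ p ∈ Icc (-r) r, |U p L - p * L - u0| ≤ B * L * L := by
    intro p hp
    have hd : ∀ x ∈ Icc 0 L, HasDerivWithinAt (fun x => U p x - p * x) (W p x - p * 1)
        (Icc 0 L) x := fun x hx => (hU p hp x hx).sub ((hasDerivWithinAt_id x _).const_mul p)
    have := (convex_Icc 0 L).norm_image_sub_le_of_norm_hasDerivWithin_le (C := B * L)
      hd (fun x hx => by rw [mul_one]; exact hWp p hp x hx) h0m hLm
    rw [hU0 p hp, Real.norm_eq_abs, Real.norm_eq_abs, sub_zero, abs_of_nonneg hL.le,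
      mul_zero, sub_zero] at this
    exact this
  have hcont : ContinuousOn (fun p => U p L) (Icc (-r) r) := by
    refine continuous_fst.comp_continuousOn (hαc.comp (f := fun p : ℝ => ((u0, p), L)) ?_ ?_)
    · fun_prop
    · intro p hp; exact ⟨hball p hp, hLm⟩
  have hrL : r * L = |u1 - u0| + B * L * L := by
    rw [hr]; field_simp
  have hmem : u1 ∈ Icc (U (-r) L) (U r L) := by
    have ha := abs_le.1 (hUL (-r) ⟨le_rfl, by linarith⟩)
    have hb := abs_le.1 (hUL r ⟨by linarith, le_rfl⟩)
    have h3 := le_abs_self (u1 - u0)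
    have h4 := neg_abs_le (u1 - u0)
    constructor <;> nlinarith
  obtain ⟨p, hp, hpu⟩ := intermediate_value_Icc (by linarith : -r ≤ r) hcont hmem
  exact ⟨U p, W p, hU p hp, hW p hp, hU0 p hp, hpu⟩


lemma aux_barrier (S : Set ℝ) (hSo : IsOpen S) (f f1 : ℝ → ℝ)
    (hd : ∀ y ∈ S, HasDerivAt f (f1 y) y) (hanti : AntitoneOn f1 S) (hpos : ∀ y ∈ S, 0 < f y)
    (τ : ℝ) (hτ : τ ∈ S) (L : ℝ) (hL : 0 < L)
    (halt : (∃ d ∈ S, τ < d ∧ f1 d ≤ 0) ∨ Ici τ ⊆ S) :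
    ∃ d ∈ S, τ < d ∧ ∃ w w1 w2 : ℝ → ℝ, (∀ x, HasDerivAt w (w1 x) x) ∧
      (∀ x, HasDerivAt w1 (w2 x) x) ∧ ∀ x ∈ Icc 0 L, ∃ y ∈ Icc τ d,
        w x = (∫ s in τ..y, (f s ^ 2)⁻¹) ∧ w2 x ≤ -(f1 y / f y) := by
  by_cases hcase : ∃ d ∈ S, τ < d ∧ f1 d ≤ 0
  · obtain ⟨d, hdS, hτd, hfd⟩ := hcase
    refine ⟨d, hdS, hτd, fun _ => ∫ s in τ..d, (f s ^ 2)⁻¹, fun _ => 0, fun _ => 0,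
      fun x => hasDerivAt_const _ _, fun x => hasDerivAt_const _ _, fun x _ =>
      ⟨d, ⟨hτd.le, le_rfl⟩, rfl, ?_⟩⟩
    have := div_nonpos_of_nonpos_of_nonneg hfd (hpos d hdS).le
    linarith
  have hIci : Ici τ ⊆ S := halt.resolve_left hcase
  push Not at hcase
  have hf1 : ∀ y, τ ≤ y → 0 < f1 y := by
    intro y hy
    have h1 : y + 1 ∈ S := hIci (show τ ≤ y + 1 by linarith)
    exact (hcase (y + 1) h1 (by linarith)).trans_le (hanti (hIci hy) h1 (by linarith))
  set p := f1 τ with hp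
  set q := f τ with hq
  have hp0 : 0 < p := hf1 τ le_rfl
  have hq0 : 0 < q := hpos τ hτ
  let Φ : ℝ → ℝ := fun y => ∫ s in τ..y, (f s ^ 2)⁻¹
  have hgc : ContinuousOn (fun s => (f s ^ 2)⁻¹) S := by
    intro s hs
    exact (((hd s hs).continuousAt.pow 2).inv₀ (pow_pos (hpos s hs) 2).ne').continuousWithinAt
  have hΦ : ∀ y, τ ≤ y → HasDerivAt Φ (f y ^ 2)⁻¹ y := by
    intro y hy
    have hyS := hIci hy
    apply intervalIntegral.integral_hasDerivAt_right
    · apply ContinuousOn.intervalIntegrable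
      apply hgc.mono
      rw [uIcc_of_le hy]
      exact fun z hz => hIci hz.1
    · exact hgc.stronglyMeasurableAtFilter hSo y hyS
    · exact hgc.continuousAt (hSo.mem_nhds hyS)
  have hΦ0 : Φ τ = 0 := by simp [Φ]
  have hΦc : ContinuousOn Φ (Ici τ) := fun y hy => (hΦ y hy).continuousAt.continuousWithinAt
  have hΦm : StrictMonoOn Φ (Ici τ) := by
    apply strictMonoOn_of_deriv_pos (convex_Ici τ) hΦc
    intro y hy
    rw [interior_Ici] at hy
    rw [(hΦ y (le_of_lt hy)).deriv]
    have := hpos y (hIci (mem_Ici.2 (le_of_lt hy)))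
    positivity
  have hivt : ∀ d, τ ≤ d → ∀ v, 0 ≤ v → v ≤ Φ d → ∃ y ∈ Icc τ d, Φ y = v := by
    intro d hτd v hv hvd
    have := intermediate_value_Icc hτd (hΦc.mono Icc_subset_Ici_self)
    exact this ⟨by rw [hΦ0]; exact hv, hvd⟩
  have hfm : MonotoneOn f (Ici τ) := by
    apply monotoneOn_of_deriv_nonneg (convex_Ici τ)
    · exact fun y hy => (hd y (hIci hy)).continuousAt.continuousWithinAt
    · intro y hy
      rw [interior_Ici] at hy
      exact (hd y (hIci (mem_Ici.2 (le_of_lt hy)))).differentiableAt.differentiableWithinAt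
    · intro y hy
      rw [interior_Ici] at hy
      rw [(hd y (hIci (mem_Ici.2 (le_of_lt hy)))).deriv]
      exact (hf1 y (le_of_lt hy)).le
  by_cases hbd : ∃ d, τ < d ∧ p / (8 * q) * L ^ 2 ≤ Φ d
  · obtain ⟨d, hτd, hΦd⟩ := hbd
    refine ⟨d, hIci hτd.le, hτd, fun x => p / (2 * q) * (x * (L - x)),
      fun x => p / (2 * q) * (L - 2 * x), fun x => - (p / q), fun x => ?_, fun x => ?_, ?_⟩
    · have := ((hasDerivAt_id x).mul ((hasDerivAt_const x L).sub (hasDerivAt_id x))).const_mul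
        (p / (2 * q))
      refine HasDerivAt.congr_deriv (f := fun x => p / (2 * q) * (x * (L - x))) this ?_
      change p / (2 * q) * (1 * (L - x) + x * (0 - 1)) = _
      ring
    · have := ((hasDerivAt_const x L).sub ((hasDerivAt_id x).const_mul 2)).const_mul
        (p / (2 * q))
      refine HasDerivAt.congr_deriv (f := fun x => p / (2 * q) * (L - 2 * x)) this ?_
      field_simp; ring
    · intro x hx
      obtain ⟨y, hy, hyΦ⟩ := hivt d hτd.le (p / (2 * q) * (x * (L - x)))
        (mul_nonneg (by positivity) (mul_nonneg hx.1 (by linarith [hx.2]))) (by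
          refine le_trans ?_ hΦd
          have : x * (L - x) ≤ L ^ 2 / 4 := by nlinarith [sq_nonneg (x - L / 2)]
          calc p / (2 * q) * (x * (L - x)) ≤ p / (2 * q) * (L ^ 2 / 4) := by gcongr
            _ = _ := by field_simp; ring)
      refine ⟨y, hy, hyΦ.symm, ?_⟩
      have h1 : f1 y ≤ p := hanti hτ (hIci hy.1) hy.1
      have h2 : q ≤ f y := hfm self_mem_Ici hy.1 hy.1
      have : f1 y / f y ≤ p / q := by gcongr
      linarith
  push Not at hbd
  have hbdd : BddAbove (Φ '' Ici τ) := by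
    refine ⟨p / (8 * q) * L ^ 2, ?_⟩
    rintro _ ⟨y, hy, rfl⟩
    have h1 := hbd (y + 1) (by have : τ ≤ y := hy; linarith)
    have h2 : Φ y ≤ Φ (y + 1) := hΦm.monotoneOn hy
      (show τ ≤ y + 1 by have : τ ≤ y := hy; linarith) (by linarith)
    linarith
  set β := sSup (Φ '' Ici τ) with hβ
  have hΦβ : ∀ y, τ ≤ y → Φ y ≤ β := fun y hy => le_csSup hbdd ⟨y, hy, rfl⟩
  have hβ0 : 0 < β := by
    have h1 := hΦm (self_mem_Ici (a := τ)) (show τ + 1 ∈ Ici τ from (by simp)) (by linarith)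
    rw [hΦ0] at h1
    exact h1.trans_le (hΦβ _ (by linarith))
  have key : ∀ y, τ ≤ y → f1 y / f y ≤ p ^ 2 * (β - Φ y) := by
    intro y hy
    have hyS := hIci hy
    have a0 := hf1 y hy
    have b0 := hpos y hyS
    have htan : ∀ s, y ≤ s → f s ≤ f y + f1 y * (s - y) := by
      intro s hs
      have := (convex_Ici y).image_sub_le_mul_sub_of_deriv_le (f := f) (C := f1 y)
        (fun z hz => (hd z (hIci (le_trans hy hz))).continuousAt.continuousWithinAt)
        (fun z hz => by
          rw [interior_Ici] at hz
          exact (hd z (hIci (hy.trans (le_of_lt hz)))).differentiableAt.differentiableWithinAt)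
        (fun z hz => by
          rw [interior_Ici] at hz
          rw [(hd z (hIci (hy.trans (le_of_lt hz)))).deriv]
          exact hanti hyS (hIci (hy.trans (le_of_lt hz))) (le_of_lt hz))
        y (show y ≤ y from le_rfl) s hs hs
      linarith
    have hkd : ∀ s, y ≤ s → HasDerivAt (fun s => Φ s + (f1 y)⁻¹ * (f y + f1 y * (s - y))⁻¹)
        ((f s ^ 2)⁻¹ - ((f y + f1 y * (s - y)) ^ 2)⁻¹) s := by
      intro s hs
      have hne : f y + f1 y * (s - y) ≠ 0 := by
        have : 0 ≤ f1 y * (s - y) := mul_nonneg a0.le (by linarith)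
        linarith
      have := (hΦ s (hy.trans hs)).add ((((((hasDerivAt_id s).sub_const y).const_mul
        (f1 y)).const_add (f y)).fun_inv hne).const_mul (f1 y)⁻¹)
      refine HasDerivAt.congr_deriv
        (f := fun s => Φ s + (f1 y)⁻¹ * (f y + f1 y * (s - y))⁻¹) this ?_
      change (f s ^ 2)⁻¹ + (f1 y)⁻¹ * (-(f1 y * 1) / (f y + f1 y * (s - y)) ^ 2) = _
      have := a0.ne'
      rw [mul_one, neg_div, mul_neg, ← mul_div_assoc, inv_mul_cancel₀ this, one_div]
      rfl
    have hkm : MonotoneOn (fun s => Φ s + (f1 y)⁻¹ * (f y + f1 y * (s - y))⁻¹) (Ici y) := by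
      apply monotoneOn_of_deriv_nonneg (convex_Ici y)
      · exact fun s hs => (hkd s hs).continuousAt.continuousWithinAt
      · intro s hs
        rw [interior_Ici] at hs
        exact (hkd s (le_of_lt hs)).differentiableAt.differentiableWithinAt
      · intro s hs
        rw [interior_Ici] at hs
        rw [(hkd s (le_of_lt hs)).deriv, sub_nonneg]
        have h1 := hpos s (hIci (hy.trans (le_of_lt hs)))
        have h2 := htan s (le_of_lt hs)
        gcongr
    have hlim : Tendsto (fun s => β + (f1 y)⁻¹ * (f y + f1 y * (s - y))⁻¹) atTop
        (𝓝 (β + (f1 y)⁻¹ * 0)) := by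
      refine tendsto_const_nhds.add (tendsto_const_nhds.mul (tendsto_inv_atTop_zero.comp ?_))
      apply tendsto_atTop_add_const_left
      apply Tendsto.const_mul_atTop a0
      exact tendsto_atTop_add_const_right _ (-y) tendsto_id
    have hle : Φ y + (f1 y)⁻¹ * (f y)⁻¹ ≤ β + (f1 y)⁻¹ * 0 := by
      refine ge_of_tendsto hlim ?_
      filter_upwards [eventually_ge_atTop y] with s hs
      have h1 := hkm (self_mem_Ici (a := y)) hs hs
      simp only [sub_self, mul_zero, add_zero] at h1
      have h2 := hΦβ s (hy.trans hs)
      linarith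
    have hpy : f1 y ≤ p := hanti hτ hyS hy
    calc f1 y / f y = (f1 y) ^ 2 * ((f1 y)⁻¹ * (f y)⁻¹) := by field_simp
      _ ≤ p ^ 2 * ((f1 y)⁻¹ * (f y)⁻¹) := by gcongr
      _ ≤ p ^ 2 * (β - Φ y) := by
        apply mul_le_mul_of_nonneg_left _ (by positivity)
        linarith
  set ε := β / Real.cosh (p * (L / 2)) with hε
  have hε0 : 0 < ε := div_pos hβ0 (Real.cosh_pos _)
  obtain ⟨_, ⟨d, hτd, rfl⟩, hdΦ⟩ := exists_lt_of_lt_csSup (s := Φ '' Ici τ) ⟨_, ⟨τ, self_mem_Ici, rfl⟩⟩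
    (show β - ε < sSup (Φ '' Ici τ) by linarith)
  have hτd' : τ ≤ d := hτd
  have hdΦ' : β - ε < Φ (d + 1) := hdΦ.trans (hΦm hτd (show τ ≤ d + 1 by linarith) (by linarith))
  refine ⟨d + 1, hIci (show τ ≤ d + 1 by linarith), by linarith,
    fun x => β - ε * Real.cosh (p * (x - L / 2)),
    fun x => - (ε * (p * Real.sinh (p * (x - L / 2)))),
    fun x => - (p ^ 2 * (ε * Real.cosh (p * (x - L / 2)))), fun x => ?_, fun x => ?_, ?_⟩
  · have h1 : HasDerivAt (fun x => p * (x - L / 2)) (p * 1) x :=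
      ((hasDerivAt_id x).sub_const (L / 2)).const_mul p
    have := (h1.cosh.const_mul ε).const_sub β
    exact this.congr_deriv (by ring)
  · have h1 : HasDerivAt (fun x => p * (x - L / 2)) (p * 1) x :=
      ((hasDerivAt_id x).sub_const (L / 2)).const_mul p
    have := ((h1.sinh.const_mul p).const_mul ε).fun_neg
    exact this.congr_deriv (by ring)
  · intro x hx
    have hc1 : Real.cosh (p * (x - L / 2)) ≤ Real.cosh (p * (L / 2)) := by
      rw [Real.cosh_le_cosh, abs_mul, abs_mul]
      refine mul_le_mul_of_nonneg_left ?_ (abs_nonneg p)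
      rw [abs_of_pos (by linarith : 0 < L / 2)]
      exact abs_le.2 ⟨by linarith [hx.1], by linarith [hx.2]⟩
    have hc2 := Real.one_le_cosh (p * (x - L / 2))
    have hc3 : ε * Real.cosh (p * (L / 2)) = β := div_mul_cancel₀ _ (Real.cosh_pos _).ne'
    obtain ⟨y, hy, hyΦ⟩ := hivt (d + 1) (by linarith) (β - ε * Real.cosh (p * (x - L / 2)))
      (by rw [sub_nonneg, ← hc3]; gcongr) (by
        have : ε * 1 ≤ ε * Real.cosh (p * (x - L / 2)) := by gcongr
        linarith)
    refine ⟨y, hy, hyΦ.symm, ?_⟩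
    have := key y hy.1
    rw [hyΦ] at this
    have e : β - (β - ε * Real.cosh (p * (x - L / 2))) = ε * Real.cosh (p * (x - L / 2)) := by ring
    rw [e] at this
    linarith


lemma aux_curve (S : Set ℝ) (hSo : IsOpen S) (hS : S.OrdConnected) (f f1 f2 : ℝ → ℝ)
    (hd : ∀ y ∈ S, HasDerivAt f (f1 y) y) (hd1 : ∀ y ∈ S, HasDerivAt f1 (f2 y) y)
    (hf2c : ContinuousOn f2 S) (hf2 : ∀ y ∈ S, f2 y ≤ 0) (hpos : ∀ y ∈ S, 0 < f y)
    (hR : ∀ τ ∈ S, (∃ d ∈ S, τ < d ∧ f1 d ≤ 0) ∨ Ici τ ⊆ S)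
    (hLf : ∀ τ ∈ S, (∃ d ∈ S, d < τ ∧ 0 ≤ f1 d) ∨ Iic τ ⊆ S)
    (τ0 τ1 : ℝ) (h0 : τ0 ∈ S) (h1 : τ1 ∈ S) (L : ℝ) (hL : 0 < L) :
    ∃ τ v : ℝ → ℝ, (∀ x ∈ Icc 0 L, τ x ∈ S) ∧
      (∀ x ∈ Icc 0 L, HasDerivWithinAt τ (f (τ x) ^ 2 * v x) (Icc 0 L) x) ∧
      (∀ x ∈ Icc 0 L, HasDerivWithinAt v (-(f1 (τ x) / f (τ x))) (Icc 0 L) x) ∧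
      τ 0 = τ0 ∧ τ L = τ1 := by
  have hScv : Convex ℝ S := hS.convex
  have hanti : AntitoneOn f1 S := by
    apply antitoneOn_of_deriv_nonpos hScv
    · exact fun y hy => (hd1 y hy).continuousAt.continuousWithinAt
    · exact fun y hy =>
        (hd1 y (interior_subset hy)).differentiableAt.differentiableWithinAt
    · intro y hy
      rw [(hd1 y (interior_subset hy)).deriv]
      exact hf2 y (interior_subset hy)
  let H : ℝ → ℝ := fun y => -(f1 y / f y)
  let H1 : ℝ → ℝ := fun y => -((f2 y * f y - f1 y * f1 y) / f y ^ 2)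
  have hH : ∀ y ∈ S, HasDerivAt H (H1 y) y := fun y hy =>
    ((hd1 y hy).fun_div (hd y hy) (hpos y hy).ne').fun_neg
  have hHm : MonotoneOn H S := by
    apply monotoneOn_of_deriv_nonneg hScv
    · exact fun y hy => (hH y hy).continuousAt.continuousWithinAt
    · exact fun y hy =>
        (hH y (interior_subset hy)).differentiableAt.differentiableWithinAt
    · intro y hy
      have hy := interior_subset hy
      rw [(hH y hy).deriv]
      have a := hpos y hy
      have b := hf2 y hy
      have : (f2 y * f y - f1 y * f1 y) / f y ^ 2 ≤ 0 :=
        div_nonpos_of_nonpos_of_nonneg (by nlinarith [mul_self_nonneg (f1 y)]) (by positivity)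
      change 0 ≤ -((f2 y * f y - f1 y * f1 y) / f y ^ 2)
      linarith
  have hfc : ContinuousOn f S := fun y hy => (hd y hy).continuousAt.continuousWithinAt
  have hf1c : ContinuousOn f1 S := fun y hy => (hd1 y hy).continuousAt.continuousWithinAt
  have hHc : ContinuousOn H S := fun y hy => (hH y hy).continuousAt.continuousWithinAt
  have hH1c : ContinuousOn H1 S :=
    (((hf2c.mul hfc).sub (hf1c.mul hf1c)).div (hfc.pow 2)
      (fun y hy => (pow_pos (hpos y hy) 2).ne')).neg
  set T := max τ0 τ1 with hTdef
  set m := min τ0 τ1 with hmdef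
  have hTS : T ∈ S := by rcases max_choice τ0 τ1 with h | h <;> rw [hTdef, h] <;> assumption
  have hmS : m ∈ S := by rcases min_choice τ0 τ1 with h | h <;> rw [hmdef, h] <;> assumption
  have hmT : m ≤ T := min_le_max
  obtain ⟨d, hdS, hTd, w, w1, w2, hw, hw1, hwy⟩ :=
    aux_barrier S hSo f f1 hd hanti hpos T hTS L hL (hR T hTS)
  obtain ⟨c', hcS', hmc', z, z1, z2, hz, hz1, hzy⟩ :=
    aux_barrier (Neg.neg ⁻¹' S) (hSo.preimage continuous_neg) (fun y => f (-y)) (fun y => -f1 (-y))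
      (fun y hy => ((hd (-y) hy).scomp y (hasDerivAt_neg y)).congr_deriv (by simp))
      (fun y hy y' hy' hyy => neg_le_neg (hanti hy' hy (neg_le_neg hyy)))
      (fun y hy => hpos (-y) hy) (-m) (by simpa using hmS) L hL (by
        rcases hLf m hmS with ⟨e, he, hem, hfe⟩ | h
        · exact Or.inl ⟨-e, by simpa using he, by linarith, by simpa using hfe⟩
        · refine Or.inr fun y hy => h ?_
          have : -m ≤ y := hy
          exact mem_Iic.2 (by linarith))
  set c := -c' with hc
  have hcS : c ∈ S := hcS'
  have hcm : c < m := by linarith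
  have hcd : c ≤ d := by linarith
  have hcdS : Icc c d ⊆ S := hS.out hcS hdS
  let cl : ℝ → ℝ := fun y => projIcc c d hcd y
  have hclc : Continuous cl := continuous_subtype_val.comp continuous_projIcc
  have hclm : ∀ y, cl y ∈ Icc c d := fun y => (projIcc c d hcd y).2
  have hcle : ∀ y ∈ Icc c d, cl y = y := fun y hy => by
    change ((projIcc c d hcd y : Icc c d) : ℝ) = y
    rw [projIcc_of_mem hcd hy]
  have hclmono : Monotone cl := fun y y' h => monotone_projIcc hcd h
  let g : ℝ → ℝ := fun y => (f (cl y) ^ 2)⁻¹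
  have hgc : Continuous g := by
    have : Continuous (fun y => f (cl y)) := hfc.comp_continuous hclc fun y => hcdS (hclm y)
    exact (this.pow 2).inv₀ fun y => (pow_pos (hpos _ (hcdS (hclm y))) 2).ne'
  have hgpos : ∀ y, 0 < g y := fun y => inv_pos.2 (pow_pos (hpos _ (hcdS (hclm y))) 2)
  obtain ⟨e, he, hemin⟩ := isCompact_Icc.exists_isMinOn (nonempty_Icc.2 hcd) hgc.continuousOn
  have hge : ∀ y, g e ≤ g y := fun y => by
    have h2 : g (cl y) = g y := by
      change (f (cl (cl y)) ^ 2)⁻¹ = (f (cl y) ^ 2)⁻¹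
      rw [hcle _ (hclm y)]
    rw [← h2]
    exact hemin (hclm y)
  obtain ⟨φ, ψ, -, hφ, hφm, hψφ, hφψ, hψ⟩ := aux_diffeo g hgc (g e) (hgpos e) hge c
  have hψm : Monotone ψ := fun a b hab => by
    by_contra! hlt
    have := hφm hlt
    rw [hφψ, hφψ] at this
    linarith
  have hψl : LipschitzWith (g e)⁻¹.toNNReal ψ := by
    apply lipschitzWith_of_nnnorm_deriv_le (fun u => (hψ u).differentiableAt)
    intro u
    rw [(hψ u).deriv, ← NNReal.coe_le_coe, coe_nnnorm, Real.norm_eq_abs,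
      abs_of_pos (inv_pos.2 (hgpos _)), Real.coe_toNNReal _ (inv_pos.2 (hgpos _)).le]
    exact inv_anti₀ (hgpos e) (hge _)
  obtain ⟨K, hK⟩ : ∃ K : ℝ≥0, LipschitzOnWith K H (Icc c d) := by
    obtain ⟨C, hC⟩ := isCompact_Icc.exists_bound_of_continuousOn (hH1c.mono hcdS)
    refine ⟨C.toNNReal, (convex_Icc c d).lipschitzOnWith_of_nnnorm_hasDerivWithin_le
      (fun y hy => (hH y (hcdS hy)).hasDerivWithinAt) fun y hy => ?_⟩
    rw [← NNReal.coe_le_coe, coe_nnnorm]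
    exact (hC y hy).trans (Real.le_coe_toNNReal C)
  obtain ⟨B, hB⟩ := isCompact_Icc.exists_bound_of_continuousOn (hHc.mono hcdS)
  let F : ℝ → ℝ := fun u => H (cl (ψ u))
  have hFl : LipschitzWith (K * (1 * (g e)⁻¹.toNNReal)) F :=
    hK.to_restrict.comp ((LipschitzWith.projIcc hcd).comp hψl)
  obtain ⟨u, v, hu, hv, hu0, huL⟩ := aux_bvp F _ hFl B (fun u => hB _ (hclm _)) L hL (φ τ0) (φ τ1)
  have hint : ∀ y y', c ≤ y → y ≤ y' → y' ≤ d → (∫ s in y..y', (f s ^ 2)⁻¹) = φ y' - φ y := by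
    intro y y' h1 h2 h3
    rw [← intervalIntegral.integral_eq_sub_of_hasDerivAt (fun s _ => hφ s)
      (hgc.intervalIntegrable _ _)]
    apply intervalIntegral.integral_congr
    intro s hs
    rw [uIcc_of_le h2] at hs
    change (f s ^ 2)⁻¹ = (f (cl s) ^ 2)⁻¹
    rw [hcle s ⟨h1.trans hs.1, hs.2.trans h3⟩]
  have huc : ContinuousOn u (Icc 0 L) := fun x hx => (hu x hx).continuousWithinAt
  have hui : ∀ x ∈ Ioo 0 L, HasDerivAt u (v x) x := fun x hx =>
    (hu x (Ioo_subset_Icc_self hx)).hasDerivAt (Icc_mem_nhds hx.1 hx.2)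
  have hvi : ∀ x ∈ Ioo 0 L, HasDerivAt v (F (u x)) x := fun x hx =>
    (hv x (Ioo_subset_Icc_self hx)).hasDerivAt (Icc_mem_nhds hx.1 hx.2)
  have hwc : Continuous w := continuous_iff_continuousAt.2 fun y => (hw y).continuousAt
  have hzc : Continuous z := continuous_iff_continuousAt.2 fun y => (hz y).continuousAt
  have hF1 : ∀ y ∈ Icc c d, ∀ a, φ y ≤ a → H y ≤ F a := by
    intro y hy a ha
    refine hHm (hcdS hy) (hcdS (hclm _)) ?_
    calc y = cl (ψ (φ y)) := by rw [hψφ, hcle y hy]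
      _ ≤ cl (ψ a) := hclmono (hψm ha)
  have hF2 : ∀ y ∈ Icc c d, ∀ a, a ≤ φ y → F a ≤ H y := by
    intro y hy a ha
    refine hHm (hcdS (hclm _)) (hcdS hy) ?_
    calc cl (ψ a) ≤ cl (ψ (φ y)) := hclmono (hψm ha)
      _ = y := by rw [hψφ, hcle y hy]
  have hwy' : ∀ x ∈ Icc 0 L, ∃ y ∈ Icc T d, φ T + w x = φ y ∧ w2 x ≤ H y := by
    intro x hx
    obtain ⟨y, hy, h1, h2⟩ := hwy x hx
    refine ⟨y, hy, ?_, h2⟩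
    rw [h1, hint T y (by linarith) hy.1 hy.2]; ring
  have hzy' : ∀ x ∈ Icc 0 L, ∃ y ∈ Icc c m, φ m - z x = φ y ∧ H y ≤ -z2 x := by
    intro x hx
    obtain ⟨y, hy, h1, h2⟩ := hzy x hx
    refine ⟨-y, ⟨by linarith [hy.2], by linarith [hy.1]⟩, ?_, ?_⟩
    · rw [h1, intervalIntegral.integral_comp_neg (fun s => (f s ^ 2)⁻¹), neg_neg,
        hint (-y) m (by linarith [hy.2]) (by linarith [hy.1]) (by linarith)]; ring
    · rw [neg_div, neg_neg] at h2
      change -(f1 (-y) / f (-y)) ≤ - z2 x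
      linarith
  have h0m : (0 : ℝ) ∈ Icc 0 L := ⟨le_rfl, hL.le⟩
  have hLm : L ∈ Icc 0 L := ⟨hL.le, le_rfl⟩
  have hup : ∀ x ∈ Icc 0 L, u x - (φ T + w x) ≤ 0 := by
    apply aux_max L _ (fun x => v x - w1 x) (fun x => F (u x) - w2 x)
    · exact huc.sub (continuous_const.add hwc).continuousOn
    · exact fun x hx => (hui x hx).sub ((hw x).const_add _)
    · exact fun x hx => (hvi x hx).sub (hw1 x)
    · intro x hx hp
      obtain ⟨y, hy, h1, h2⟩ := hwy' x (Ioo_subset_Icc_self hx)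
      rw [h1] at hp
      have := hF1 y ⟨by linarith [hy.1], hy.2⟩ (u x) (by linarith)
      linarith
    · obtain ⟨y, hy, h1, h2⟩ := hwy' 0 h0m
      rw [h1, hu0, sub_nonpos]
      exact hφm.monotone ((le_max_left _ _).trans hy.1)
    · obtain ⟨y, hy, h1, h2⟩ := hwy' L hLm
      rw [h1, huL, sub_nonpos]
      exact hφm.monotone ((le_max_right _ _).trans hy.1)
  have hlow : ∀ x ∈ Icc 0 L, (φ m - z x) - u x ≤ 0 := by
    apply aux_max L _ (fun x => -z1 x - v x) (fun x => -z2 x - F (u x))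
    · exact (continuous_const.sub hzc).continuousOn.sub huc
    · exact fun x hx => ((hz x).const_sub _).sub (hui x hx)
    · exact fun x hx => (hz1 x).fun_neg.sub (hvi x hx)
    · intro x hx hp
      obtain ⟨y, hy, h1, h2⟩ := hzy' x (Ioo_subset_Icc_self hx)
      rw [h1] at hp
      have := hF2 y ⟨hy.1, by linarith [hy.2]⟩ (u x) (by linarith)
      linarith
    · obtain ⟨y, hy, h1, h2⟩ := hzy' 0 h0m
      rw [h1, hu0, sub_nonpos]
      exact hφm.monotone (hy.2.trans (min_le_left _ _))
    · obtain ⟨y, hy, h1, h2⟩ := hzy' L hLm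
      rw [h1, huL, sub_nonpos]
      exact hφm.monotone (hy.2.trans (min_le_right _ _))
  have hτm : ∀ x ∈ Icc 0 L, ψ (u x) ∈ Icc c d := by
    intro x hx
    constructor
    · obtain ⟨y, hy, h1, -⟩ := hzy' x hx
      have := hlow x hx
      rw [h1, sub_nonpos] at this
      calc c ≤ y := hy.1
        _ = ψ (φ y) := (hψφ y).symm
        _ ≤ ψ (u x) := hψm this
    · obtain ⟨y, hy, h1, -⟩ := hwy' x hx
      have := hup x hx
      rw [h1, sub_nonpos] at this
      calc ψ (u x) ≤ ψ (φ y) := hψm this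
        _ = y := hψφ y
        _ ≤ d := hy.2
  refine ⟨fun x => ψ (u x), v, fun x hx => hcdS (hτm x hx), fun x hx => ?_, fun x hx => ?_, ?_, ?_⟩
  · refine ((hψ (u x)).comp_hasDerivWithinAt x (hu x hx)).congr_deriv ?_
    change (((f (cl (ψ (u x)))) ^ 2)⁻¹)⁻¹ * v x = _
    rw [hcle _ (hτm x hx), inv_inv]
  · refine (hv x hx).congr_deriv ?_
    change H (cl (ψ (u x))) = H (ψ (u x))
    rw [hcle _ (hτm x hx)]
  · change ψ (u 0) = τ0
    rw [hu0, hψφ]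
  · change ψ (u L) = τ1
    rw [huL, hψφ]

theorem aux_geo (S : Set ℝ) (f f1 : ℝ → ℝ)
    (hd : ∀ y ∈ S, HasDerivAt f (f1 y) y)
    (hf1c : ContinuousOn f1 S)
    (hpos : ∀ y ∈ S, 0 < f y) (L : ℝ) (hL : 0 < L) (τ v : ℝ → ℝ)
    (hτS : ∀ x ∈ Icc 0 L, τ x ∈ S)
    (hτ : ∀ x ∈ Icc 0 L, HasDerivWithinAt τ (f (τ x) ^ 2 * v x) (Icc 0 L) x)
    (hv : ∀ x ∈ Icc 0 L, HasDerivWithinAt v (-(f1 (τ x) / f (τ x))) (Icc 0 L) x)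
    (x0 s : ℝ) (hs : s ^ 2 = 1) :
    ∃ (σ X : ℝ → ℝ) (T : ℝ), 0 < T ∧ (∀ t ∈ Icc 0 T, σ t ∈ S) ∧
      (∀ t ∈ Icc 0 T, ∃ r ∈ Icc 0 L, X t = x0 + s * r) ∧
      ContDiffOn ℝ 2 σ (Icc 0 T) ∧ ContDiffOn ℝ 2 X (Icc 0 T) ∧
      (∀ t ∈ Icc 0 T, derivWithin (derivWithin σ (Icc 0 T)) (Icc 0 T) t
        = -(f (σ t) * f1 (σ t) * (derivWithin X (Icc 0 T) t) ^ 2)) ∧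
      (∀ t ∈ Icc 0 T, derivWithin (derivWithin X (Icc 0 T)) (Icc 0 T) t
        = -(2 * (f1 (σ t) / f (σ t)) * derivWithin σ (Icc 0 T) t * derivWithin X (Icc 0 T) t)) ∧
      σ 0 = τ 0 ∧ X 0 = x0 ∧ σ T = τ L ∧ X T = x0 + s * L := by
  have hτc : ContinuousOn τ (Icc 0 L) := fun x hx => (hτ x hx).continuousWithinAt
  have hvc : ContinuousOn v (Icc 0 L) := fun x hx => (hv x hx).continuousWithinAt
  have hfc : ContinuousOn f S := fun x hx => (hd x hx).continuousAt.continuousWithinAt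
  have hgc : ContinuousOn (fun x => f (τ x) ^ 2) (Icc 0 L) := (hfc.comp hτc hτS).pow 2
  obtain ⟨xm, hxm, hmin⟩ := isCompact_Icc.exists_isMinOn (nonempty_Icc.2 hL.le) hgc
  let g : ℝ → ℝ := fun x => f (τ (projIcc 0 L hL.le x)) ^ 2
  have hg : Continuous g := by
    have := (continuousOn_iff_continuous_domRestrict.1 hgc).comp (continuous_projIcc (h := hL.le))
    exact this
  have hgI : ∀ x ∈ Icc 0 L, g x = f (τ x) ^ 2 := by
    intro x hx; simp only [g, projIcc_of_mem hL.le hx]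
  obtain ⟨φ, X, hφ0, hφ, hmono, hXφ, hφX, hX⟩ := aux_diffeo g hg (f (τ xm) ^ 2)
    (pow_pos (hpos _ (hτS _ hxm)) 2) (fun y => hmin (projIcc 0 L hL.le y).2) 0
  have hX0 : X 0 = 0 := by have := hXφ 0; rwa [hφ0] at this
  have hXT : X (φ L) = L := hXφ L
  have hT : 0 < φ L := by rw [← hφ0]; exact hmono hL
  have hXI : MapsTo X (Icc 0 (φ L)) (Icc 0 L) := by
    intro t ht
    constructor
    · rw [← hmono.le_iff_le, hφ0, hφX]; exact ht.1
    · rw [← hmono.le_iff_le, hφX]; exact ht.2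
  have hXd : ∀ t ∈ Icc 0 (φ L), HasDerivWithinAt X (f (τ (X t)) ^ 2)⁻¹ (Icc 0 (φ L)) t := by
    intro t ht
    have := (hX t).hasDerivWithinAt (s := Icc 0 (φ L))
    rwa [hgI _ (hXI ht)] at this
  have hXc : ContinuousOn X (Icc 0 (φ L)) := fun x hx => (hXd x hx).continuousWithinAt
  have hσS : ∀ t ∈ Icc 0 (φ L), τ (X t) ∈ S := fun t ht => hτS _ (hXI ht)
  have hfp : ∀ t ∈ Icc 0 (φ L), f (τ (X t)) ≠ 0 := fun t ht => (hpos _ (hσS t ht)).ne'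
  have hσd : ∀ t ∈ Icc 0 (φ L), HasDerivWithinAt (fun t => τ (X t)) (v (X t)) (Icc 0 (φ L)) t := by
    intro t ht
    have h1 := (hτ _ (hXI ht)).comp t (hXd t ht) hXI
    refine h1.congr_deriv ?_
    have := hfp t ht
    field_simp
  have hvd : ∀ t ∈ Icc 0 (φ L), HasDerivWithinAt (fun t => v (X t))
      (-(f1 (τ (X t)) / f (τ (X t))) * (f (τ (X t)) ^ 2)⁻¹) (Icc 0 (φ L)) t := by
    intro t ht
    exact (hv _ (hXI ht)).comp t (hXd t ht) hXI
  have hfd : ∀ t ∈ Icc 0 (φ L), HasDerivWithinAt (fun t => f (τ (X t)))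
      (f1 (τ (X t)) * v (X t)) (Icc 0 (φ L)) t := by
    intro t ht
    exact (hd _ (hσS t ht)).comp_hasDerivWithinAt t (hσd t ht)
  have hqd : ∀ t ∈ Icc 0 (φ L), HasDerivWithinAt (fun t => s * (f (τ (X t)) ^ 2)⁻¹)
      (s * (-(2 * (f (τ (X t))) * (f1 (τ (X t)) * v (X t))) / (f (τ (X t)) ^ 2) ^ 2))
      (Icc 0 (φ L)) t := by
    intro t ht
    have := (((hfd t ht).pow 2).inv (pow_ne_zero 2 (hfp t ht))).const_mul s
    refine this.congr_deriv ?_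
    simp
  have hσc : ContinuousOn (fun t => τ (X t)) (Icc 0 (φ L)) := hτc.comp hXc hXI
  have hvXc : ContinuousOn (fun t => v (X t)) (Icc 0 (φ L)) := hvc.comp hXc hXI
  have hfσ : ContinuousOn (fun t => f (τ (X t))) (Icc 0 (φ L)) := hfc.comp hσc hσS
  have hf1σ : ContinuousOn (fun t => f1 (τ (X t))) (Icc 0 (φ L)) := hf1c.comp hσc hσS
  obtain ⟨a1, a2, a3⟩ := aux_C2 (φ L) hT _ _ _ hσd hvd
    (((hf1σ.div hfσ hfp).neg).mul ((hfσ.pow 2).inv₀ fun t ht => pow_ne_zero 2 (hfp t ht)))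
  obtain ⟨b1, b2, b3⟩ := aux_C2 (φ L) hT (fun t => x0 + s * X t) _ _
    (fun t ht => ((hXd t ht).const_mul s).const_add x0) hqd
    (continuousOn_const.mul ((((continuousOn_const.mul hfσ).mul (hf1σ.mul hvXc)).neg).div
      ((hfσ.pow 2).pow 2) fun t ht => pow_ne_zero 2 (pow_ne_zero 2 (hfp t ht))))
  refine ⟨fun t => τ (X t), fun t => x0 + s * X t, φ L, hT, hσS,
    fun t ht => ⟨X t, hXI ht, rfl⟩, a1, b1, ?_, ?_, by simp [hX0], by simp [hX0],
    by simp [hXT], by simp [hXT]⟩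
  · intro t ht
    rw [a3 t ht, b2 t ht, mul_pow, hs]
    have := hfp t ht
    field_simp
  · intro t ht
    rw [b3 t ht, b2 t ht, a2 t ht]
    have := hfp t ht
    field_simp

open Set Filter MeasureTheory Topology GRW
open scoped ENNReal

theorem aux_right (aE bE : EReal) (f : ℝ → ℝ)
    (hfd : ∀ τ ∈ II aE bE, HasDerivAt f (deriv f τ) τ) (hfpos : ∀ τ ∈ II aE bE, 0 < f τ)
    (hinext_b : bE ≠ ⊤ → Tendsto f (Fb bE) (𝓝 0)) (τ : ℝ) (hτ : τ ∈ II aE bE) :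
    (∃ d ∈ II aE bE, τ < d ∧ deriv f d ≤ 0) ∨ Ici τ ⊆ II aE bE := by
  by_cases hb : bE = ⊤
  · right
    intro y hy
    exact ⟨lt_of_lt_of_le hτ.1 (EReal.coe_le_coe_iff.2 hy), hb ▸ EReal.coe_lt_top y⟩
  · left
    have hev : ∀ᶠ y in Fb bE, f y < f τ := (hinext_b hb).eventually_lt_const (hfpos τ hτ)
    rw [Fb, eventually_comap] at hev
    have hev2 : ∀ᶠ z in 𝓝[<] bE, z ∈ Ioo (τ : EReal) bE := Ioo_mem_nhdsLT hτ.2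
    have hne : (𝓝[<] bE).NeBot := nhdsLT_neBot_of_exists_lt ⟨_, hτ.2⟩
    obtain ⟨z, hz1, hz2⟩ := (hev.and hev2).exists
    have hzr : ((z.toReal : ℝ) : EReal) = z :=
      EReal.coe_toReal (hz2.2.trans_le le_top).ne ((EReal.bot_lt_coe τ).trans hz2.1).ne'
    set e := z.toReal
    have hlt := hz1 e hzr
    rw [← hzr] at hz2
    have hτe : τ < e := EReal.coe_lt_coe_iff.1 hz2.1
    have hsub : ∀ y ∈ Icc τ e, y ∈ II aE bE := fun y hy =>
      ⟨lt_of_lt_of_le hτ.1 (EReal.coe_le_coe_iff.2 hy.1),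
        lt_of_le_of_lt (EReal.coe_le_coe_iff.2 hy.2) hz2.2⟩
    obtain ⟨d, hd, hd'⟩ := exists_hasDerivAt_eq_slope f (deriv f) hτe
      (fun y hy => (hfd y (hsub y hy)).continuousAt.continuousWithinAt)
      (fun y hy => hfd y (hsub y (Ioo_subset_Icc_self hy)))
    refine ⟨d, hsub d (Ioo_subset_Icc_self hd), hd.1, ?_⟩
    rw [hd']
    exact div_nonpos_of_nonpos_of_nonneg (by linarith) (by linarith)

theorem aux_left (aE bE : EReal) (f : ℝ → ℝ)
    (hfd : ∀ τ ∈ II aE bE, HasDerivAt f (deriv f τ) τ) (hfpos : ∀ τ ∈ II aE bE, 0 < f τ)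
    (hinext_a : aE ≠ ⊥ → Tendsto f (Fa aE) (𝓝 0)) (τ : ℝ) (hτ : τ ∈ II aE bE) :
    (∃ d ∈ II aE bE, d < τ ∧ 0 ≤ deriv f d) ∨ Iic τ ⊆ II aE bE := by
  by_cases hb : aE = ⊥
  · right
    intro y hy
    exact ⟨hb ▸ EReal.bot_lt_coe y, lt_of_le_of_lt (EReal.coe_le_coe_iff.2 hy) hτ.2⟩
  · left
    have hev : ∀ᶠ y in Fa aE, f y < f τ := (hinext_a hb).eventually_lt_const (hfpos τ hτ)
    rw [Fa, eventually_comap] at hev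
    have hev2 : ∀ᶠ z in 𝓝[>] aE, z ∈ Ioo aE (τ : EReal) := Ioo_mem_nhdsGT hτ.1
    have hne : (𝓝[>] aE).NeBot := nhdsGT_neBot_of_exists_gt ⟨_, hτ.1⟩
    obtain ⟨z, hz1, hz2⟩ := (hev.and hev2).exists
    have hzr : ((z.toReal : ℝ) : EReal) = z :=
      EReal.coe_toReal (hz2.2.trans (EReal.coe_lt_top τ)).ne (bot_le.trans_lt hz2.1).ne'
    set e := z.toReal
    have hlt := hz1 e hzr
    rw [← hzr] at hz2
    have hτe : e < τ := EReal.coe_lt_coe_iff.1 hz2.2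
    have hsub : ∀ y ∈ Icc e τ, y ∈ II aE bE := fun y hy =>
      ⟨lt_of_lt_of_le hz2.1 (EReal.coe_le_coe_iff.2 hy.1),
        lt_of_le_of_lt (EReal.coe_le_coe_iff.2 hy.2) hτ.2⟩
    obtain ⟨d, hd, hd'⟩ := exists_hasDerivAt_eq_slope f (deriv f) hτe
      (fun y hy => (hfd y (hsub y hy)).continuousAt.continuousWithinAt)
      (fun y hy => hfd y (hsub y (Ioo_subset_Icc_self hy)))
    refine ⟨d, hsub d (Ioo_subset_Icc_self hd), hd.2, ?_⟩
    rw [hd']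
    exact div_nonneg (by linarith) (by linarith)

theorem aux_II_ord (aE bE : EReal) : (II aE bE).OrdConnected :=
  ⟨fun _ hx _ hy _ hz => ⟨lt_of_lt_of_le hx.1 (EReal.coe_le_coe_iff.2 hz.1),
    lt_of_le_of_lt (EReal.coe_le_coe_iff.2 hz.2) hy.2⟩⟩

theorem aux_II_open (aE bE : EReal) : IsOpen (II aE bE) :=
  (isOpen_lt continuous_const continuous_coe_real_ereal).inter
    (isOpen_lt continuous_coe_real_ereal continuous_const)

/-- If `f'' ≤ 0` on `(a,b)` (the timelike convergence condition
`Ric(∂_τ,∂_τ) ≥ 0`) and the GRW spacetime is inextendible (`f → 0` at every finite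
extreme of `(a,b)`), then it is geodesically connected. -/
theorem geodesically_connected_of_concave_inextendible
    (aE bE : EReal) (hab : aE < bE) (f : ℝ → ℝ)
    (hf : ContDiffOn ℝ (⊤ : ℕ∞) f (II aE bE)) (hfpos : ∀ τ ∈ II aE bE, 0 < f τ)
    (J : Set ℝ) (hJ : ∃ c d : EReal, c < d ∧ J = {x : ℝ | c < (x : EReal) ∧ (x : EReal) < d})
    (hconc : ∀ τ ∈ II aE bE, deriv (deriv f) τ ≤ 0)
    (hinext_b : bE ≠ ⊤ → Tendsto f (Fb bE) (𝓝 0))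
    (hinext_a : aE ≠ ⊥ → Tendsto f (Fa aE) (𝓝 0)) :
    GeodConnected aE bE f J := by
  have hSo := aux_II_open aE bE
  have hS := aux_II_ord aE bE
  have hJo : J.OrdConnected := by
    obtain ⟨c, d, -, rfl⟩ := hJ
    exact aux_II_ord c d
  have hfd : ∀ τ ∈ II aE bE, HasDerivAt f (deriv f τ) τ := fun τ hτ =>
    ((hf.contDiffAt (hSo.mem_nhds hτ)).differentiableAt (by simp)).hasDerivAt
  have hf1 : ContDiffOn ℝ (⊤ : ℕ∞) (deriv f) (II aE bE) :=
    hf.deriv_of_isOpen hSo (by simp)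
  have hfd1 : ∀ τ ∈ II aE bE, HasDerivAt (deriv f) (deriv (deriv f) τ) τ := fun τ hτ =>
    ((hf1.contDiffAt (hSo.mem_nhds hτ)).differentiableAt (by simp)).hasDerivAt
  have hf2 : ContDiffOn ℝ (⊤ : ℕ∞) (deriv (deriv f)) (II aE bE) :=
    hf1.deriv_of_isOpen hSo (by simp)
  intro τ0 x0 τ0' x0' h0 hx0 h0' hx0'
  by_cases hx : x0 = x0'
  · subst hx
    obtain ⟨a1, a2, a3⟩ := aux_C2 1 one_pos (fun t => τ0 + t * (τ0' - τ0))
      (fun _ => τ0' - τ0) (fun _ => 0)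
      (fun t _ => by
        simpa using (((hasDerivAt_id t).mul_const (τ0' - τ0)).const_add τ0).hasDerivWithinAt)
      (fun t _ => hasDerivWithinAt_const _ _ _) continuousOn_const
    refine ⟨fun t => τ0 + t * (τ0' - τ0), fun _ => x0, 1, zero_le_one,
      ⟨?_, fun _ _ => hx0, a1, contDiffOn_const, ?_, ?_⟩, by simp, rfl, by simp, rfl⟩
    · intro t ht
      have := hS.convex.add_smul_sub_mem h0 h0' ht
      simpa using this
    · intro t ht
      rw [a3 t ht]; simp
    · intro t ht
      simp
  · have hL : 0 < |x0' - x0| := abs_pos.2 (sub_ne_zero.2 (Ne.symm hx))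
    obtain ⟨τ, v, hτS, hτ, hv, e0, e1⟩ := aux_curve (II aE bE) hSo hS f (deriv f)
      (deriv (deriv f)) hfd hfd1 hf2.continuousOn hconc hfpos
      (fun τ hτ => aux_right aE bE f hfd hfpos hinext_b τ hτ)
      (fun τ hτ => aux_left aE bE f hfd hfpos hinext_a τ hτ) τ0 τ0' h0 h0' _ hL
    obtain ⟨s, hs, hsL⟩ : ∃ s : ℝ, s ^ 2 = 1 ∧ x0 + s * |x0' - x0| = x0' := by
      rcases abs_cases (x0' - x0) with h | h
      · exact ⟨1, by norm_num, by rw [h.1]; ring⟩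
      · exact ⟨-1, by norm_num, by rw [h.1]; ring⟩
    obtain ⟨σ, X, T, hT, m1, m2, c1, c2, q1, q2, i1, i2, i3, i4⟩ := aux_geo (II aE bE) f (deriv f)
      hfd hf1.continuousOn hfpos _ hL τ v hτS hτ hv x0 s hs
    refine ⟨σ, X, T, hT.le, ⟨m1, ?_, c1, c2, q1, q2⟩, i1.trans e0, i2, i3.trans e1, i4.trans hsL⟩
    intro t ht
    obtain ⟨r, hr, hX⟩ := m2 t ht
    have hk : r / |x0' - x0| ∈ Icc (0:ℝ) 1 :=
      ⟨div_nonneg hr.1 hL.le, (div_le_one hL).2 hr.2⟩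
    have := hJo.convex.add_smul_sub_mem hx0 hx0' hk
    have e : x0' - x0 = s * |x0' - x0| := by linarith
    convert this using 1
    rw [hX, smul_eq_mul]
    nth_rewrite 2 [e]
    field_simp
end
end

section
/- Suppose f'' ≤ 0 on (a,b) and let a < â < b̂ < b. Then the strip (â, b̂) × J, endowed with the restricted metric −dτ² + f(τ)² dx², is geodesically connected if and only if f'(â) ≥ 0 and f'(b̂) ≤ 0. -/
open Set Filter MeasureTheory Topology
open scoped ENNReal NNReal

noncomputable section

open Set Filter MeasureTheory Topology GRW
open scoped ENNReal

namespace GRWaux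

lemma mono_of {u p : ℝ → ℝ} {a b : ℝ}
    (hd : ∀ t ∈ Icc a b, HasDerivWithinAt u (p t) (Icc a b) t)
    (hp : ∀ t ∈ Icc a b, 0 ≤ p t) : MonotoneOn u (Icc a b) := by
  refine monotoneOn_of_hasDerivWithinAt_nonneg (f' := p) (convex_Icc a b)
    (fun t ht => (hd t ht).continuousWithinAt) ?_ ?_
  · intro t ht
    exact (hd t (interior_subset ht)).mono interior_subset
  · intro t ht
    exact hp t (interior_subset ht)

/-- Key comparison at an interior minimum. -/
lemma mp_core {μ : ℝ} {v p r : ℝ → ℝ}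
    (hv : ∀ t ∈ Icc (0:ℝ) 1, HasDerivAt v (p t) t)
    (hp : ∀ t ∈ Icc (0:ℝ) 1, HasDerivAt p (r t) t)
    (hr : ∀ t ∈ Icc (0:ℝ) 1, r t ≤ μ ^ 2 * v t)
    {m : ℝ} (hm : m ∈ Ioo (0:ℝ) 1) (hmin : ∀ t ∈ Icc (0:ℝ) 1, v m ≤ v t) :
    v 1 ≤ v m * Real.cosh (μ * (1 - m)) := by
  have hp0 : p m = 0 := by
    have : IsLocalMin v m := by
      filter_upwards [Icc_mem_nhds hm.1 hm.2] with t ht using hmin t ht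
    exact this.hasDerivAt_eq_zero (hv m ⟨hm.1.le, hm.2.le⟩)
  have hc : ∀ t, HasDerivAt (fun t => Real.cosh (μ * (t - m))) (μ * Real.sinh (μ * (t - m))) t := by
    intro t
    have h1 : HasDerivAt (fun t => μ * (t - m)) μ t := by
      simpa using ((hasDerivAt_id t).sub_const m).const_mul μ
    simpa [mul_comm] using h1.cosh
  have hs : ∀ t, HasDerivAt (fun t => Real.sinh (μ * (t - m))) (μ * Real.cosh (μ * (t - m))) t := by
    intro t
    have h1 : HasDerivAt (fun t => μ * (t - m)) μ t := by
      simpa using ((hasDerivAt_id t).sub_const m).const_mul μ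
    simpa [mul_comm] using h1.sinh
  have hsub : ∀ t ∈ Icc m 1, t ∈ Icc (0:ℝ) 1 := fun t ht => ⟨hm.1.le.trans ht.1, ht.2⟩
  have m1 : m ∈ Icc m 1 := ⟨le_rfl, hm.2.le⟩
  have m2 : (1:ℝ) ∈ Icc m 1 := ⟨hm.2.le, le_rfl⟩
  -- the Wronskian is nonincreasing
  have hW : MonotoneOn (fun t => -(p t * Real.cosh (μ * (t - m))
      - v t * (μ * Real.sinh (μ * (t - m))))) (Icc m 1) := by
    refine mono_of (p := fun t => (μ ^ 2 * v t - r t) * Real.cosh (μ * (t - m))) ?_ ?_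
    · intro t ht
      have := (((hp t (hsub t ht)).mul (hc t)).sub ((hv t (hsub t ht)).mul ((hs t).const_mul μ))).neg
      refine HasDerivAt.hasDerivWithinAt ?_
      exact this.congr_deriv (by ring)
    · intro t ht
      exact mul_nonneg (by linarith [hr t (hsub t ht)]) (Real.cosh_pos _).le
  have hW0 : ∀ t ∈ Icc m 1, p t * Real.cosh (μ * (t - m))
      - v t * (μ * Real.sinh (μ * (t - m))) ≤ 0 := by
    intro t ht
    have := hW m1 ht ht.1
    simp [hp0] at this
    linarith
  have hQ : MonotoneOn (fun t => -(v t / Real.cosh (μ * (t - m)))) (Icc m 1) := by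
    refine mono_of (p := fun t => -((p t * Real.cosh (μ * (t - m))
      - v t * (μ * Real.sinh (μ * (t - m)))) / Real.cosh (μ * (t - m)) ^ 2)) ?_ ?_
    · intro t ht
      exact (((hv t (hsub t ht)).div (hc t) (Real.cosh_pos _).ne').neg).hasDerivWithinAt
    · intro t ht
      rw [neg_nonneg]
      exact div_nonpos_of_nonpos_of_nonneg (hW0 t ht) (by positivity)
  have := hQ m1 m2 hm.2.le
  simp only [sub_self, mul_zero, Real.cosh_zero, div_one] at this
  have h2 : v 1 / Real.cosh (μ * (1 - m)) ≤ v m := by linarith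
  rwa [div_le_iff₀ (Real.cosh_pos _)] at h2

lemma mp_strong {μ : ℝ} {v p r : ℝ → ℝ}
    (hv : ∀ t ∈ Icc (0:ℝ) 1, HasDerivAt v (p t) t)
    (hp : ∀ t ∈ Icc (0:ℝ) 1, HasDerivAt p (r t) t)
    (hr : ∀ t ∈ Icc (0:ℝ) 1, r t ≤ μ ^ 2 * v t) (h0 : 0 < v 0) (h1 : 0 < v 1) :
    ∀ t ∈ Icc (0:ℝ) 1, 0 < v t := by
  obtain ⟨m, hm, hmin⟩ := isCompact_Icc.exists_isMinOn (nonempty_Icc.2 (zero_le_one' ℝ))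
    (fun t ht => (hv t ht).continuousAt.continuousWithinAt)
  suffices 0 < v m from fun t ht => this.trans_le (hmin ht)
  by_contra hneg
  push Not at hneg
  have hmm : m ∈ Ioo (0:ℝ) 1 := by
    refine ⟨lt_of_le_of_ne hm.1 ?_, lt_of_le_of_ne hm.2 ?_⟩
    · rintro rfl; linarith
    · rintro rfl; linarith
  have := mp_core hv hp hr hmm (fun t ht => hmin ht)
  nlinarith [Real.cosh_pos (μ * (1 - m))]

lemma mp_weak {μ : ℝ} {v p r : ℝ → ℝ}
    (hv : ∀ t ∈ Icc (0:ℝ) 1, HasDerivAt v (p t) t)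
    (hp : ∀ t ∈ Icc (0:ℝ) 1, HasDerivAt p (r t) t)
    (hr : ∀ t ∈ Icc (0:ℝ) 1, r t ≤ μ ^ 2 * v t) (h0 : 0 ≤ v 0) (h1 : 0 ≤ v 1) :
    ∀ t ∈ Icc (0:ℝ) 1, 0 ≤ v t := by
  obtain ⟨m, hm, hmin⟩ := isCompact_Icc.exists_isMinOn (nonempty_Icc.2 (zero_le_one' ℝ))
    (fun t ht => (hv t ht).continuousAt.continuousWithinAt)
  suffices 0 ≤ v m from fun t ht => this.trans (hmin ht)
  by_contra hneg
  push Not at hneg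
  have hmm : m ∈ Ioo (0:ℝ) 1 := by
    refine ⟨lt_of_le_of_ne hm.1 ?_, lt_of_le_of_ne hm.2 ?_⟩
    · rintro rfl; linarith
    · rintro rfl; linarith
  have := mp_core hv hp hr hmm (fun t ht => hmin ht)
  nlinarith [Real.cosh_pos (μ * (1 - m))]

/-- contraction constant -/
def KK (μ : ℝ) : ℝ := 1 - 1 / Real.cosh (μ / 2)

lemma KK_lt (μ : ℝ) : KK μ < 1 := by
  have := Real.cosh_pos (μ / 2)
  unfold KK
  have : 0 < 1 / Real.cosh (μ / 2) := by positivity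
  linarith

lemma KK_nonneg (μ : ℝ) : 0 ≤ KK μ := by
  unfold KK
  have : 1 / Real.cosh (μ / 2) ≤ 1 := by
    rw [div_le_one (Real.cosh_pos _)]; exact Real.one_le_cosh _
  linarith

lemma est_one {μ D : ℝ} (hD : 0 ≤ D) {u p g : ℝ → ℝ}
    (hu : ∀ t ∈ Icc (0:ℝ) 1, HasDerivAt u (p t) t)
    (hp : ∀ t ∈ Icc (0:ℝ) 1, HasDerivAt p (μ ^ 2 * u t + g t) t)
    (hg : ∀ t ∈ Icc (0:ℝ) 1, -g t ≤ μ ^ 2 * D) (h0 : u 0 = 0) (h1 : u 1 = 0) :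
    ∀ t ∈ Icc (0:ℝ) 1, u t ≤ KK μ * D := by
  set k := Real.cosh (μ / 2) with hk
  have hkpos : 0 < k := Real.cosh_pos _
  have harg : ∀ t, HasDerivAt (fun t => μ * (t - 1 / 2)) μ t := fun t => by
    simpa only [id, mul_one] using ((hasDerivAt_id t).sub_const (1/2)).const_mul μ
  have hc : ∀ t, HasDerivAt (fun t => Real.cosh (μ * (t - 1/2))) (μ * Real.sinh (μ * (t - 1/2))) t := by
    intro t
    exact (harg t).cosh.congr_deriv (by ring)
  have hs : ∀ t, HasDerivAt (fun t => Real.sinh (μ * (t - 1/2))) (μ * Real.cosh (μ * (t - 1/2))) t := by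
    intro t
    exact (harg t).sinh.congr_deriv (by ring)
  have key := mp_weak (μ := μ) (v := fun t => D * (1 - Real.cosh (μ * (t - 1/2)) / k) - u t)
    (p := fun t => D * (- (μ * Real.sinh (μ * (t - 1/2)) / k)) - p t)
    (r := fun t => D * (- (μ * (μ * Real.cosh (μ * (t - 1/2))) / k)) - (μ ^ 2 * u t + g t))
    (fun t ht => ?_) (fun t ht => ?_) (fun t ht => ?_) ?_ ?_
  · intro t ht
    have h2 := key t ht
    have h3 : 1 / k ≤ Real.cosh (μ * (t - 1/2)) / k := by
      gcongr; exact Real.one_le_cosh _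
    have : D * (1 - Real.cosh (μ * (t - 1/2)) / k) ≤ D * (1 - 1 / k) := by
      apply mul_le_mul_of_nonneg_left _ hD; linarith
    unfold KK
    rw [← hk]
    linarith
  · exact ((((hc t).div_const k).const_sub 1).const_mul D).sub (hu t ht)
  · exact ((((((hs t).const_mul μ).div_const k)).neg).const_mul D).sub (hp t ht)
  · have := hg t ht
    have e : D * (- (μ * (μ * Real.cosh (μ * (t - 1/2))) / k)) = 
      μ ^ 2 * (D * (1 - Real.cosh (μ * (t - 1/2)) / k)) - μ ^ 2 * D := by ring
    rw [e]; nlinarith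
  · have : μ * (0 - 1/2) = -(μ/2) := by ring
    simp only [this, Real.cosh_neg, ← hk, h0, div_self hkpos.ne']; simp
  · have : μ * (1 - 1/2) = (μ/2) := by ring
    simp only [this, ← hk, h1, div_self hkpos.ne']; simp

lemma est {μ D : ℝ} (hD : 0 ≤ D) {u p g : ℝ → ℝ}
    (hu : ∀ t ∈ Icc (0:ℝ) 1, HasDerivAt u (p t) t)
    (hp : ∀ t ∈ Icc (0:ℝ) 1, HasDerivAt p (μ ^ 2 * u t + g t) t)
    (hg : ∀ t ∈ Icc (0:ℝ) 1, |g t| ≤ μ ^ 2 * D) (h0 : u 0 = 0) (h1 : u 1 = 0) :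
    ∀ t ∈ Icc (0:ℝ) 1, |u t| ≤ KK μ * D := by
  intro t ht
  rw [abs_le]
  constructor
  · have := est_one (μ := μ) hD (u := fun t => - u t) (p := fun t => - p t) (g := fun t => - g t)
      (fun t ht => (hu t ht).neg) (fun t ht => by
        exact (hp t ht).neg.congr_deriv (by ring))
      (fun t ht => by simpa using (abs_le.1 (hg t ht)).2) (by simp [h0]) (by simp [h1]) t ht
    linarith
  · exact est_one (μ := μ) hD hu hp (fun t ht => by linarith [(abs_le.1 (hg t ht)).1]) h0 h1 t ht

lemma lin {μ : ℝ} (hμ : 0 < μ) {g : ℝ → ℝ} (hg : Continuous g) (a b : ℝ) :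
    ∃ u p : ℝ → ℝ, (∀ t, HasDerivAt u (p t) t) ∧
      (∀ t, HasDerivAt p (μ ^ 2 * u t + g t) t) ∧ u 0 = a ∧ u 1 = b := by
  have hc : ∀ t, HasDerivAt (fun t => Real.cosh (μ * t)) (μ * Real.sinh (μ * t)) t := by
    intro t
    have h1 : HasDerivAt (fun t => μ * t) μ t := by
      simpa using (hasDerivAt_id t).const_mul μ
    simpa [mul_comm] using h1.cosh
  have hs : ∀ t, HasDerivAt (fun t => Real.sinh (μ * t)) (μ * Real.cosh (μ * t)) t := by
    intro t
    have h1 : HasDerivAt (fun t => μ * t) μ t := by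
      simpa using (hasDerivAt_id t).const_mul μ
    simpa [mul_comm] using h1.sinh
  have hcc : Continuous (fun t => Real.cosh (μ * t) * g t) := by fun_prop
  have hsc : Continuous (fun t => Real.sinh (μ * t) * g t) := by fun_prop
  set P : ℝ → ℝ := fun t => ∫ s in (0:ℝ)..t, Real.cosh (μ * s) * g s with hP
  set Q : ℝ → ℝ := fun t => ∫ s in (0:ℝ)..t, Real.sinh (μ * s) * g s with hQ
  have dP : ∀ t, HasDerivAt P (Real.cosh (μ * t) * g t) t := fun t =>
    intervalIntegral.integral_hasDerivAt_right (hcc.intervalIntegrable _ _)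
      (hcc.stronglyMeasurableAtFilter _ _) hcc.continuousAt
  have dQ : ∀ t, HasDerivAt Q (Real.sinh (μ * t) * g t) t := fun t =>
    intervalIntegral.integral_hasDerivAt_right (hsc.intervalIntegrable _ _)
      (hsc.stronglyMeasurableAtFilter _ _) hsc.continuousAt
  have P0 : P 0 = 0 := by simp [hP]
  have Q0 : Q 0 = 0 := by simp [hQ]
  have hsinh : 0 < Real.sinh μ := Real.sinh_pos_iff.2 hμ
  obtain ⟨β, hβ⟩ : ∃ β, a * Real.cosh μ + β * Real.sinh μ
      + (Real.sinh μ * P 1 - Real.cosh μ * Q 1) / μ = b := by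
    refine ⟨(b - a * Real.cosh μ - (Real.sinh μ * P 1 - Real.cosh μ * Q 1) / μ) / Real.sinh μ, ?_⟩
    rw [div_mul_cancel₀ _ hsinh.ne']; ring
  refine ⟨fun t => a * Real.cosh (μ * t) + β * Real.sinh (μ * t)
      + (Real.sinh (μ * t) * P t - Real.cosh (μ * t) * Q t) / μ,
    fun t => a * (μ * Real.sinh (μ * t)) + β * (μ * Real.cosh (μ * t))
      + (Real.cosh (μ * t) * P t - Real.sinh (μ * t) * Q t), ?_, ?_, ?_, ?_⟩
  · intro t
    have := ((((hc t).const_mul a).add ((hs t).const_mul β)).add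
      ((((hs t).mul (dP t)).sub ((hc t).mul (dQ t))).div_const μ))
    refine this.congr_deriv ?_
    field_simp
    ring
  · intro t
    have := (((((hs t).const_mul μ).const_mul a).add (((hc t).const_mul μ).const_mul β)).add
      (((hc t).mul (dP t)).sub ((hs t).mul (dQ t))))
    refine this.congr_deriv ?_
    have e := Real.cosh_sq (μ * t)
    have e2 : g t = (Real.cosh (μ * t) ^ 2 - Real.sinh (μ * t) ^ 2) * g t := by rw [e]; ring
    have e3 : μ ^ 2 * ((Real.sinh (μ * t) * P t - Real.cosh (μ * t) * Q t) / μ) =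
      μ * (Real.sinh (μ * t) * P t - Real.cosh (μ * t) * Q t) := by field_simp
    rw [mul_add, e3]
    linear_combination -e2
  · simp [P0, Q0]
  · simpa using hβ

end GRWaux

namespace GRWaux

lemma abs_shift {F : ℝ → ℝ} {μ : ℝ}
    (hF : ∀ x y, x ≤ y → 0 ≤ F y - F x ∧ F y - F x ≤ 2 * μ ^ 2 * (y - x)) (x y : ℝ) :
    |(F x - μ ^ 2 * x) - (F y - μ ^ 2 * y)| ≤ μ ^ 2 * |x - y| := by
  rcases le_total x y with hxy | hxy
  · obtain ⟨h1, h2⟩ := hF x y hxy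
    rw [abs_of_nonpos (by linarith : x - y ≤ 0), abs_le]
    constructor <;> nlinarith
  · obtain ⟨h1, h2⟩ := hF y x hxy
    rw [abs_of_nonneg (by linarith : 0 ≤ x - y), abs_le]
    constructor <;> nlinarith

lemma bvp {F : ℝ → ℝ} {μ : ℝ} (hμ : 0 < μ) (hFc : Continuous F)
    (hF : ∀ x y, x ≤ y → 0 ≤ F y - F x ∧ F y - F x ≤ 2 * μ ^ 2 * (y - x)) (a b : ℝ) :
    ∃ u p : ℝ → ℝ, (∀ t, HasDerivAt u (p t) t) ∧
      (∀ t ∈ Icc (0:ℝ) 1, HasDerivAt p (F (u t)) t) ∧ u 0 = a ∧ u 1 = b := by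
  let X : C(Icc (0:ℝ) 1, ℝ) → ℝ → ℝ := fun z => IccExtend zero_le_one z
  have hX : ∀ z, Continuous (X z) := fun z => z.continuous.Icc_extend'
  have hXe : ∀ z, ∀ t (ht : t ∈ Icc (0:ℝ) 1), X z t = z ⟨t, ht⟩ := fun z t ht =>
    IccExtend_of_mem _ _ ht
  have hg : ∀ z, Continuous (fun t => F (X z t) - μ ^ 2 * X z t) := fun z => by
    have := hX z
    fun_prop
  choose U P hU hP h0 h1 using fun z => lin hμ (hg z) a b
  let T : C(Icc (0:ℝ) 1, ℝ) → C(Icc (0:ℝ) 1, ℝ) := fun z =>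
    ⟨fun t => U z t, by
      have : Continuous (U z) := continuous_iff_continuousAt.2 fun t => (hU z t).continuousAt
      fun_prop⟩
  have hT : ContractingWith (Real.toNNReal (KK μ)) T := by
    refine ⟨?_, ?_⟩
    · rw [← NNReal.coe_lt_coe, Real.coe_toNNReal _ (KK_nonneg μ)]; exact KK_lt μ
    · refine LipschitzWith.of_dist_le_mul fun z w => ?_
      rw [Real.coe_toNNReal _ (KK_nonneg μ), ContinuousMap.dist_le (mul_nonneg (KK_nonneg μ) dist_nonneg)]
      rintro ⟨t, ht⟩
      rw [Real.dist_eq]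
      refine est (μ := μ) (u := fun t => U z t - U w t) (p := fun t => P z t - P w t)
        (g := fun t => (F (X z t) - μ ^ 2 * X z t) - (F (X w t) - μ ^ 2 * X w t))
        dist_nonneg (fun t _ => (hU z t).sub (hU w t))
        (fun t _ => ((hP z t).sub (hP w t)).congr_deriv (by ring)) ?_ ?_ ?_ t ht
      · intro t ht
        refine (abs_shift hF _ _).trans ?_
        gcongr
        rw [hXe z t ht, hXe w t ht, ← Real.dist_eq]
        exact ContinuousMap.dist_apply_le_dist _
      · simp [h0]
      · simp [h1]
  have hfix : T (hT.fixedPoint T) = hT.fixedPoint T := hT.fixedPoint_isFixedPt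
  set z := hT.fixedPoint T with hz
  refine ⟨U z, P z, hU z, ?_, h0 z, h1 z⟩
  intro t ht
  refine (hP z t).congr_deriv ?_
  have : U z t = X z t := by
    rw [hXe z t ht]
    have := congrArg (fun k : C(Icc (0:ℝ) 1, ℝ) => k ⟨t, ht⟩) hfix
    exact this
  rw [this]; ring

lemma stab {F F2 : ℝ → ℝ} {μ ε : ℝ} (hμ : 0 < μ) (hε : 0 ≤ ε)
    (hF : ∀ x y, x ≤ y → 0 ≤ F y - F x ∧ F y - F x ≤ 2 * μ ^ 2 * (y - x))
    {u p v q : ℝ → ℝ}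
    (hu : ∀ t, HasDerivAt u (p t) t) (hp : ∀ t ∈ Icc (0:ℝ) 1, HasDerivAt p (F (u t)) t)
    (hv : ∀ t, HasDerivAt v (q t) t) (hq : ∀ t ∈ Icc (0:ℝ) 1, HasDerivAt q (F2 (v t)) t)
    (h0 : u 0 = v 0) (h1 : u 1 = v 1)
    (hd : ∀ t ∈ Icc (0:ℝ) 1, |F (v t) - F2 (v t)| ≤ ε) :
    ∀ t ∈ Icc (0:ℝ) 1, |u t - v t| ≤ KK μ / (1 - KK μ) * (ε / μ ^ 2) := by
  have hcont : ContinuousOn (fun t => |u t - v t|) (Icc (0:ℝ) 1) := fun t ht =>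
    ((hu t).continuousAt.sub (hv t).continuousAt).abs.continuousWithinAt
  obtain ⟨m, hm, hmax⟩ := isCompact_Icc.exists_isMaxOn (nonempty_Icc.2 (zero_le_one' ℝ)) hcont
  have hK := KK_lt μ
  have key := est (μ := μ) (D := |u m - v m| + ε / μ ^ 2) (by positivity)
    (u := fun t => u t - v t) (p := fun t => p t - q t)
    (g := fun t => ((F (u t) - μ ^ 2 * u t) - (F (v t) - μ ^ 2 * v t)) + (F (v t) - F2 (v t)))
    (fun t _ => (hu t).sub (hv t))
    (fun t ht => ((hp t ht).sub (hq t ht)).congr_deriv (by ring))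
    (by
      intro t ht
      refine (abs_add_le _ _).trans ?_
      have e1 := abs_shift hF (u t) (v t)
      have e2 : |u t - v t| ≤ |u m - v m| := hmax ht
      have e3 := hd t ht
      have e4 : μ ^ 2 * (|u m - v m| + ε / μ ^ 2) = μ ^ 2 * |u m - v m| + ε := by
        field_simp
      rw [e4]
      have : μ ^ 2 * |u t - v t| ≤ μ ^ 2 * |u m - v m| := by gcongr
      linarith) (by simp [h0]) (by simp [h1])
  have hm' : |u m - v m| ≤ KK μ * (|u m - v m| + ε / μ ^ 2) := key m hm
  intro t ht
  refine le_trans (hmax ht) ?_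
  show |u m - v m| ≤ _
  have : |u m - v m| * (1 - KK μ) ≤ KK μ * (ε / μ ^ 2) := by linarith
  rw [div_mul_eq_mul_div, le_div_iff₀ (by linarith)]
  exact this

lemma exist_core {A B L qm qM : ℝ} (hL : 0 ≤ L) {H q : ℝ → ℝ} (hHc : Continuous H)
    (hH : ∀ x y, x ≤ y → 0 ≤ H y - H x ∧ H y - H x ≤ L * (y - x))
    (hHA : ∀ y, H y ≤ L * (y - A)) (hHB : ∀ y, L * (y - B) ≤ H y)
    (hqc : Continuous q) (hqm : 0 < qm) (hq : ∀ y, qm ≤ q y ∧ q y ≤ qM)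
    {a b δ : ℝ} (ha : a ∈ Ioo A B) (hb : b ∈ Ioo A B) (hδ : 0 ≤ δ) :
    ∃ (c : ℝ) (u p : ℝ → ℝ), 0 ≤ c ∧ (∀ t, HasDerivAt u (p t) t) ∧
      (∀ t ∈ Icc (0:ℝ) 1, HasDerivAt p (c ^ 2 * H (u t)) t) ∧ u 0 = a ∧ u 1 = b ∧
      (∀ t ∈ Icc (0:ℝ) 1, u t ∈ Ioo A B) ∧ c * ∫ t in (0:ℝ)..1, q (u t) = δ := by
  set C := δ / qm with hC
  have hC0 : 0 ≤ C := by positivity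
  set μ := C * (L + 1) + 1 with hμd
  have hμ : 0 < μ := by positivity
  have hμL : C ^ 2 * L ≤ 2 * μ ^ 2 := by
    have h1 : C * (L + 1) ≤ μ := by linarith
    have h2 : (C * (L + 1)) ^ 2 ≤ μ ^ 2 := by gcongr
    have h3 : C ^ 2 * L ≤ (C * (L + 1)) ^ 2 := by nlinarith [mul_nonneg (sq_nonneg C) hL, mul_nonneg (sq_nonneg C) (mul_nonneg hL hL), sq_nonneg C]
    nlinarith [sq_nonneg μ]
  have hF : ∀ c ∈ Icc 0 C, ∀ x y, x ≤ y → 0 ≤ c ^ 2 * H y - c ^ 2 * H x ∧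
      c ^ 2 * H y - c ^ 2 * H x ≤ 2 * μ ^ 2 * (y - x) := by
    intro c hc x y hxy
    obtain ⟨h1, h2⟩ := hH x y hxy
    have hcC : c ^ 2 ≤ C ^ 2 := by have := hc.1; have := hc.2; gcongr
    refine ⟨by rw [← mul_sub]; positivity, ?_⟩
    have hyx : 0 ≤ y - x := by linarith
    calc c ^ 2 * H y - c ^ 2 * H x = c ^ 2 * (H y - H x) := by ring
      _ ≤ C ^ 2 * (L * (y - x)) := by gcongr
      _ = (C ^ 2 * L) * (y - x) := by ring
      _ ≤ _ := by gcongr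
  choose! u p hu hp h0 h1 using fun c (hc : c ∈ Icc 0 C) =>
    bvp hμ (F := fun y => c ^ 2 * H y) (by fun_prop) (hF c hc) a b
  have hrange : ∀ c ∈ Icc 0 C, ∀ t ∈ Icc (0:ℝ) 1, u c t ∈ Ioo A B := by
    intro c hc t ht
    have hcL : (c * (L + 1)) ^ 2 = c ^ 2 * (L + 1) ^ 2 := by ring
    have hsq : (c * Real.sqrt L) ^ 2 = c ^ 2 * L := by rw [mul_pow, Real.sq_sqrt hL]
    constructor
    · have := mp_strong (μ := c * Real.sqrt L) (v := fun t => u c t - A) (p := fun t => p c t)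
        (r := fun t => c ^ 2 * H (u c t)) (fun t _ => (hu c hc t).sub_const A)
        (fun t ht => hp c hc t ht) (fun t ht => by
          rw [hsq]
          have := mul_le_mul_of_nonneg_left (hHA (u c t)) (sq_nonneg c)
          linarith) (by simp [h0 c hc, ha.1]) (by simp [h1 c hc, hb.1]) t ht
      linarith
    · have := mp_strong (μ := c * Real.sqrt L) (v := fun t => B - u c t) (p := fun t => - p c t)
        (r := fun t => - (c ^ 2 * H (u c t))) (fun t _ => (hu c hc t).const_sub B)
        (fun t ht => (hp c hc t ht).neg) (fun t ht => by
          rw [hsq]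
          have := mul_le_mul_of_nonneg_left (hHB (u c t)) (sq_nonneg c)
          linarith) (by simp [h0 c hc, ha.2]) (by simp [h1 c hc, hb.2]) t ht
      linarith
  obtain ⟨M, hM⟩ : ∃ M, ∀ y ∈ Icc A B, |H y| ≤ M := by
    obtain ⟨M, hM⟩ := isCompact_Icc.exists_bound_of_continuousOn (s := Icc A B) hHc.continuousOn
    exact ⟨M, hM⟩
  have hM0 : 0 ≤ M := (abs_nonneg _).trans (hM a ⟨ha.1.le, ha.2.le⟩)
  have hcont : ∀ t ∈ Icc (0:ℝ) 1, ContinuousOn (fun c => u c t) (Icc 0 C) := by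
    intro t ht d hd
    have hb : ∀ c ∈ Icc 0 C, |u c t - u d t| ≤ KK μ / (1 - KK μ) * ((|c ^ 2 - d ^ 2| * M) / μ ^ 2) := by
      intro c hc
      refine stab (F := fun y => c ^ 2 * H y) (F2 := fun y => d ^ 2 * H y) hμ (by positivity) (hF c hc) (hu c hc) (hp c hc) (hu d hd) (hp d hd)
        (by rw [h0 c hc, h0 d hd]) (by rw [h1 c hc, h1 d hd]) ?_ t ht
      intro s hs
      rw [← sub_mul, abs_mul]
      gcongr
      exact hM _ (Ioo_subset_Icc_self (hrange d hd s hs))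
    have hlim : Tendsto (fun c => KK μ / (1 - KK μ) * ((|c ^ 2 - d ^ 2| * M) / μ ^ 2))
        (𝓝[Icc 0 C] d) (𝓝 0) := by
      have : Continuous (fun c => KK μ / (1 - KK μ) * ((|c ^ 2 - d ^ 2| * M) / μ ^ 2)) := by fun_prop
      have h2 := (this.tendsto d).mono_left (nhdsWithin_le_nhds (s := Icc 0 C))
      simpa using h2
    rw [ContinuousWithinAt, tendsto_iff_dist_tendsto_zero]
    refine squeeze_zero' (Eventually.of_forall fun _ => dist_nonneg) ?_ hlim
    filter_upwards [self_mem_nhdsWithin] with c hc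
    rw [Real.dist_eq]
    exact hb c hc
  have huc : ∀ c ∈ Icc 0 C, Continuous (u c) := fun c hc =>
    continuous_iff_continuousAt.2 fun t => (hu c hc t).continuousAt
  have hΘ : ContinuousOn (fun c => c * ∫ t in (0:ℝ)..1, q (u c t)) (Icc 0 C) := by
    refine continuousOn_id.mul ?_
    intro d hd
    refine intervalIntegral.continuousWithinAt_of_dominated_interval (bound := fun _ => qM) ?_ ?_ ?_ ?_
    · filter_upwards [self_mem_nhdsWithin] with c hc
      exact (hqc.comp (huc c hc)).aestronglyMeasurable
    · refine Eventually.of_forall fun c => ae_of_all _ fun t _ => ?_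
      rw [Real.norm_eq_abs, abs_of_nonneg (hqm.le.trans (hq _).1)]
      exact (hq _).2
    · exact intervalIntegrable_const
    · refine ae_of_all _ fun t ht => ?_
      rw [uIoc_of_le zero_le_one] at ht
      exact hqc.continuousAt.comp_continuousWithinAt (hcont t ⟨ht.1.le, ht.2⟩ d hd)
  have hiv := intermediate_value_Icc hC0 hΘ
  have hCmem : C ∈ Icc 0 C := ⟨hC0, le_rfl⟩
  have hmem : δ ∈ Icc ((0:ℝ) * ∫ t in (0:ℝ)..1, q (u 0 t)) (C * ∫ t in (0:ℝ)..1, q (u C t)) := by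
    refine ⟨by simpa using hδ, ?_⟩
    have : qm ≤ ∫ t in (0:ℝ)..1, q (u C t) := by
      have e : ∫ t in (0:ℝ)..1, qm = qm := by simp
      rw [← e]
      refine intervalIntegral.integral_mono_on zero_le_one intervalIntegrable_const
        ((hqc.comp (huc C hCmem)).intervalIntegrable _ _) fun t _ => (hq _).1
    calc δ = C * qm := by rw [hC]; field_simp
      _ ≤ _ := by gcongr
  obtain ⟨c, hc, hce⟩ := hiv hmem
  exact ⟨c, u c, p c, hc.1, hu c hc, hp c hc, h0 c hc, h1 c hc, hrange c hc, hce⟩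

end GRWaux

namespace GRWaux

lemma c2 {t1 : ℝ} (ht1 : 0 < t1) {u p r : ℝ → ℝ}
    (hu : ∀ t ∈ Icc 0 t1, HasDerivWithinAt u (p t) (Icc 0 t1) t)
    (hp : ∀ t ∈ Icc 0 t1, HasDerivWithinAt p (r t) (Icc 0 t1) t)
    (hr : ContinuousOn r (Icc 0 t1)) :
    ContDiffOn ℝ 2 u (Icc 0 t1) ∧ ∀ t ∈ Icc 0 t1, derivWithin u (Icc 0 t1) t = p t ∧
      derivWithin (derivWithin u (Icc 0 t1)) (Icc 0 t1) t = r t := by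
  have hU : UniqueDiffOn ℝ (Icc 0 t1) := uniqueDiffOn_Icc ht1
  have e1 : ∀ t ∈ Icc 0 t1, derivWithin u (Icc 0 t1) t = p t := fun t ht =>
    (hu t ht).derivWithin (hU t ht)
  have hp' : ∀ t ∈ Icc 0 t1, HasDerivWithinAt (derivWithin u (Icc 0 t1)) (r t) (Icc 0 t1) t :=
    fun t ht => (hp t ht).congr e1 (e1 t ht)
  have e2 : ∀ t ∈ Icc 0 t1, derivWithin (derivWithin u (Icc 0 t1)) (Icc 0 t1) t = r t :=
    fun t ht => (hp' t ht).derivWithin (hU t ht)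
  refine ⟨?_, fun t ht => ⟨e1 t ht, e2 t ht⟩⟩
  rw [show (2 : WithTop ℕ∞) = 1 + 1 by norm_num, contDiffOn_succ_iff_derivWithin hU]
  refine ⟨fun t ht => (hu t ht).differentiableWithinAt, by simp, ?_⟩
  rw [show (1 : WithTop ℕ∞) = 0 + 1 by norm_num, contDiffOn_succ_iff_derivWithin hU]
  refine ⟨fun t ht => (hp' t ht).differentiableWithinAt, by simp, ?_⟩
  rw [contDiffOn_zero]
  exact hr.congr e2

lemma isOpen_II (a b : EReal) : IsOpen (II a b) := by
  have : II a b = (fun x : ℝ => (x : EReal)) ⁻¹' (Ioo a b) := rfl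
  rw [this]
  exact isOpen_Ioo.preimage continuous_coe_real_ereal

lemma mem_II_coe {a b t : ℝ} : t ∈ II (a : EReal) (b : EReal) ↔ t ∈ Ioo a b := by
  simp [II]

/-- concave-type estimate at the midpoint -/
lemma mid_est {t1 k : ℝ} (ht1 : 0 < t1) {u p r : ℝ → ℝ}
    (hu : ∀ t ∈ Icc 0 t1, HasDerivWithinAt u (p t) (Icc 0 t1) t)
    (hp : ∀ t ∈ Icc 0 t1, HasDerivWithinAt p (r t) (Icc 0 t1) t)
    (hr : ∀ t ∈ Icc 0 t1, r t ≤ -k) (he : u 0 = u t1) :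
    u 0 + k * t1 ^ 2 / 8 ≤ u (t1 / 2) := by
  have hm : t1 / 2 ∈ Icc 0 t1 := ⟨by linarith, by linarith⟩
  have hq : ∀ t, HasDerivAt (fun t => k / 2 * (t * (t - t1))) (k * (t - t1 / 2)) t := fun t => by
    refine ((((hasDerivAt_id t).mul ((hasDerivAt_id t).sub_const t1))).const_mul (k/2)).congr_deriv ?_
    simp only [id]; ring
  have hl : ∀ t, HasDerivAt (fun t => k * (t - t1 / 2)) k t := fun t => by
    refine (((hasDerivAt_id t).sub_const (t1/2)).const_mul k).congr_deriv ?_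
    ring
  have dφ : ∀ t ∈ Icc 0 t1, HasDerivWithinAt (fun t => u t + k / 2 * (t * (t - t1)))
      (p t + k * (t - t1 / 2)) (Icc 0 t1) t := fun t ht => (hu t ht).add (hq t).hasDerivWithinAt
  have anti : MonotoneOn (fun t => -(p t + k * (t - t1 / 2))) (Icc 0 t1) :=
    mono_of (p := fun t => -(r t + k)) (fun t ht => ((hp t ht).add (hl t).hasDerivWithinAt).neg)
      (fun t ht => by linarith [hr t ht])
  rcases le_total 0 (p (t1/2) + k * (t1/2 - t1/2)) with hs | hs
  · have hsub : Icc 0 (t1/2) ⊆ Icc 0 t1 := Icc_subset_Icc_right hm.2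
    have := mono_of (a := 0) (b := t1/2) (fun t ht => (dφ t (hsub ht)).mono hsub)
      (fun t ht => by
        have := anti (hsub ht) hm ht.2
        simp only at this
        linarith) (left_mem_Icc.2 hm.1) (right_mem_Icc.2 hm.1) hm.1
    simp only at this
    nlinarith
  · have hsub : Icc (t1/2) t1 ⊆ Icc 0 t1 := Icc_subset_Icc_left hm.1
    have := mono_of (a := t1/2) (b := t1) (u := fun t => -(u t + k / 2 * (t * (t - t1))))
      (p := fun t => -(p t + k * (t - t1 / 2))) (fun t ht => ((dφ t (hsub ht)).neg).mono hsub)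
      (fun t ht => by
        have := anti hm (hsub ht) ht.1
        simp only at this
        linarith) (left_mem_Icc.2 hm.2) (right_mem_Icc.2 hm.2) hm.2
    simp only at this
    nlinarith

lemma nec_core {A B s k m M : ℝ} {f : ℝ → ℝ} {J : Set ℝ} (hk : 0 < k) (hm : 0 < m)
    (hfd : ∀ τ ∈ Ioo A B, HasDerivAt f (deriv f τ) τ)
    (hfb : ∀ τ ∈ Ioo A B, m ≤ f τ ∧ f τ ≤ M)
    (hfk : ∀ τ ∈ Ioo A B, k ≤ s * deriv f τ)
    {σ x : ℝ → ℝ} {t1 : ℝ} (ht1 : 0 ≤ t1)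
    (hg : IsGeodesicOn (A : EReal) (B : EReal) f J σ x 0 t1) (he : σ 0 = σ t1)
    (hx : x 0 < x t1) :
    ∃ τ ∈ Ioo A B, s * σ 0 + (k / M ^ 3) * (m ^ 2 * (x t1 - x 0)) ^ 2 / 8 ≤ s * τ := by
  have ht : 0 < t1 := by
    rcases ht1.eq_or_lt with h | h
    · subst h; exact absurd hx (lt_irrefl _)
    · exact h
  set S := Icc 0 t1 with hS
  have hU : UniqueDiffOn ℝ S := uniqueDiffOn_Icc ht
  have hmem : ∀ t ∈ S, σ t ∈ Ioo A B := fun t h => mem_II_coe.1 (hg.mem_base t h)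
  have key : ∀ y : ℝ → ℝ, ContDiffOn ℝ 2 y S → (∀ t ∈ S, HasDerivWithinAt y (derivWithin y S t) S t) ∧
      (∀ t ∈ S, HasDerivWithinAt (derivWithin y S) (derivWithin (derivWithin y S) S t) S t) := by
    intro y hy
    rw [show (2 : WithTop ℕ∞) = 1 + 1 by norm_num, contDiffOn_succ_iff_derivWithin hU] at hy
    refine ⟨fun t ht => (hy.1 t ht).hasDerivWithinAt, fun t ht => ?_⟩
    exact ((hy.2.2.differentiableOn one_ne_zero) t ht).hasDerivWithinAt
  obtain ⟨dσ, ddσ⟩ := key σ hg.smooth_base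
  obtain ⟨dx, ddx⟩ := key x hg.smooth_fiber
  set p := derivWithin σ S with hp
  set v := derivWithin x S with hv
  have h0S : (0:ℝ) ∈ S := ⟨le_rfl, ht.le⟩
  have h1S : t1 ∈ S := ⟨ht.le, le_rfl⟩
  -- first integral
  have dc : ∀ t ∈ S, HasDerivWithinAt (fun t => f (σ t) ^ 2 * v t) 0 S t := by
    intro t htS
    have hfp : 0 < f (σ t) := hm.trans_le (hfb _ (hmem t htS)).1
    have h1 : HasDerivWithinAt (fun t => f (σ t)) (deriv f (σ t) * p t) S t :=
      (hfd _ (hmem t htS)).comp_hasDerivWithinAt t (dσ t htS)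
    have h2 := (h1.pow 2).mul (ddx t htS)
    refine h2.congr_deriv ?_
    rw [hg.eq_fiber t htS, ← hS, ← hp, ← hv]
    simp only [Pi.pow_apply]
    field_simp
    ring
  have hc : ∀ t ∈ S, f (σ t) ^ 2 * v t = f (σ 0) ^ 2 * v 0 := by
    intro t htS
    have := (convex_Icc 0 t1).norm_image_sub_le_of_norm_hasDerivWithin_le (C := 0) dc
      (fun t _ => by simp) h0S htS
    simp only [zero_mul] at this
    exact sub_eq_zero.1 (norm_le_zero_iff.1 this)
  set c := f (σ 0) ^ 2 * v 0 with hcdef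
  have hM : 0 < M := hm.trans_le ((hfb _ (hmem 0 h0S)).1.trans (hfb _ (hmem 0 h0S)).2)
  have hmid := mid_est (k := k / M ^ 3 * c ^ 2) ht (u := fun t => s * σ t) (p := fun t => s * p t)
    (fun t h => (dσ t h).const_mul s) (fun t h => (ddσ t h).const_mul s) (by
      intro t htS
      rw [hg.eq_base t htS, ← hS, ← hv]
      have hfp : 0 < f (σ t) := hm.trans_le (hfb _ (hmem t htS)).1
      have hvt : v t = c / f (σ t) ^ 2 := by rw [← hc t htS]; field_simp
      have e : s * -(f (σ t) * deriv f (σ t) * v t ^ 2) = -((s * deriv f (σ t)) / f (σ t) ^ 3 * c ^ 2) := by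
        rw [hvt]; field_simp
      rw [e]
      have h1 := (hfb _ (hmem t htS)).2
      have h2 := hfk _ (hmem t htS)
      have : k / M ^ 3 ≤ (s * deriv f (σ t)) / f (σ t) ^ 3 :=
        div_le_div₀ (by linarith) h2 (by positivity) (by gcongr)
      have := mul_le_mul_of_nonneg_right this (sq_nonneg c)
      linarith) (by simp only [he])
  have hmS : t1 / 2 ∈ S := ⟨by linarith, by linarith⟩
  refine ⟨σ (t1/2), hmem _ hmS, le_trans ?_ hmid⟩
  have hlen : |x t1 - x 0| ≤ |c| / m ^ 2 * |t1 - 0| := by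
    refine (convex_Icc 0 t1).norm_image_sub_le_of_norm_hasDerivWithin_le (C := |c| / m ^ 2) dx
      (fun t htS => ?_) h0S h1S
    have hfp : 0 < f (σ t) := hm.trans_le (hfb _ (hmem t htS)).1
    have hvt : v t = c / f (σ t) ^ 2 := by rw [← hc t htS]; field_simp
    rw [hvt, Real.norm_eq_abs, abs_div, abs_of_pos (by positivity : 0 < f (σ t) ^ 2)]
    have := (hfb _ (hmem t htS)).1
    gcongr
  rw [sub_zero, abs_of_pos ht, abs_of_pos (by linarith : 0 < x t1 - x 0)] at hlen
  have h3 : m ^ 2 * (x t1 - x 0) ≤ |c| * t1 := by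
    calc m ^ 2 * (x t1 - x 0) ≤ m ^ 2 * (|c| / m ^ 2 * t1) := by gcongr
      _ = |c| * t1 := by field_simp
  have h4 : (m ^ 2 * (x t1 - x 0)) ^ 2 ≤ c ^ 2 * t1 ^ 2 := by
    have h0 : 0 ≤ m ^ 2 * (x t1 - x 0) := mul_nonneg (sq_nonneg m) (by linarith)
    calc (m ^ 2 * (x t1 - x 0)) ^ 2 ≤ (|c| * t1) ^ 2 := by gcongr
      _ = c ^ 2 * t1 ^ 2 := by rw [mul_pow, sq_abs]
  have h5 : (k / M ^ 3) * (m ^ 2 * (x t1 - x 0)) ^ 2 ≤ (k / M ^ 3) * (c ^ 2 * t1 ^ 2) := by gcongr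
  linarith

end GRWaux

namespace GRWaux

/-- sufficiency -/
lemma suff {A B : ℝ} (hAB : A < B) {f : ℝ → ℝ} {J : Set ℝ} (hJ : J.OrdConnected)
    {S : Set ℝ} (hS : IsOpen S) (hIS : Icc A B ⊆ S)
    (hf : ContDiffOn ℝ (⊤ : ℕ∞) f S) (hpos : ∀ τ ∈ S, 0 < f τ)
    (hconc : ∀ τ ∈ S, deriv (deriv f) τ ≤ 0) (hA : 0 ≤ deriv f A) (hB : deriv f B ≤ 0) :
    GeodConnected (A : EReal) (B : EReal) f J := by
  have hf1 : ContDiffOn ℝ (⊤ : ℕ∞) (deriv f) S := hf.deriv_of_isOpen hS (by simp)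
  have hf2 : ContDiffOn ℝ (⊤ : ℕ∞) (deriv (deriv f)) S := hf1.deriv_of_isOpen hS (by simp)
  have d0 : ∀ τ ∈ S, HasDerivAt f (deriv f τ) τ := fun τ h =>
    ((hf.differentiableOn (by simp)).differentiableAt (hS.mem_nhds h)).hasDerivAt
  have d1 : ∀ τ ∈ S, HasDerivAt (deriv f) (deriv (deriv f) τ) τ := fun τ h =>
    ((hf1.differentiableOn (by simp)).differentiableAt (hS.mem_nhds h)).hasDerivAt
  set H0 : ℝ → ℝ := fun y => -(deriv f y / f y ^ 3) with hH0
  set H1 : ℝ → ℝ := fun y => -((deriv (deriv f) y * f y ^ 3 - deriv f y * (3 * f y ^ 2 * deriv f y))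
      / (f y ^ 3) ^ 2) with hH1
  have dH : ∀ τ ∈ S, HasDerivAt H0 (H1 τ) τ := by
    intro τ h
    have h3 := (d0 τ h).pow 3
    have := ((d1 τ h).div h3 (by have := hpos τ h; simp only [Pi.pow_apply]; positivity)).neg
    refine this.congr_deriv ?_
    simp [hH1]
  have cH1 : ContinuousOn H1 S := by
    have c0 := hf.continuousOn
    have c1 := hf1.continuousOn
    have c2 := hf2.continuousOn
    refine ContinuousOn.neg (ContinuousOn.div (by fun_prop) (by fun_prop) ?_)
    intro τ h
    have := hpos τ h
    positivity
  have H1nn : ∀ τ ∈ S, 0 ≤ H1 τ := by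
    intro τ h
    have h1 := hpos τ h
    have h2 := hconc τ h
    simp only [hH1]
    rw [neg_nonneg]
    refine div_nonpos_of_nonpos_of_nonneg ?_ (by positivity)
    have e1 : deriv (deriv f) τ * f τ ^ 3 ≤ 0 := mul_nonpos_of_nonpos_of_nonneg h2 (by positivity)
    have e2 : 0 ≤ deriv f τ * (3 * f τ ^ 2 * deriv f τ) := by
      have : deriv f τ * (3 * f τ ^ 2 * deriv f τ) = 3 * f τ ^ 2 * (deriv f τ) ^ 2 := by ring
      rw [this]; positivity
    linarith
  obtain ⟨L, hL⟩ := isCompact_Icc.exists_bound_of_continuousOn (cH1.mono hIS)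
  have hL0 : 0 ≤ L := (norm_nonneg _).trans (hL A (left_mem_Icc.2 hAB.le))
  have cH0 : ContinuousOn H0 (Icc A B) := fun τ h => (dH τ (hIS h)).continuousAt.continuousWithinAt
  have H0m : MonotoneOn H0 (Icc A B) :=
    mono_of (fun t h => (dH t (hIS h)).hasDerivWithinAt) (fun t h => H1nn t (hIS h))
  have H0L : MonotoneOn (fun y => L * y - H0 y) (Icc A B) := by
    refine mono_of (p := fun t => L * 1 - H1 t)
      (fun t h => (((hasDerivAt_id t).const_mul L).sub (dH t (hIS h))).hasDerivWithinAt) ?_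
    intro t h
    have := (abs_le.1 (hL t h)).2
    linarith
  -- clamp
  set κ : ℝ → ℝ := fun y => max A (min y B) with hκ
  have κc : Continuous κ := by fun_prop
  have κm : ∀ y, κ y ∈ Icc A B := fun y => ⟨le_max_left _ _, max_le hAB.le (min_le_right _ _)⟩
  have κid : ∀ y ∈ Icc A B, κ y = y := fun y h => by
    simp only [hκ]; rw [min_eq_left h.2, max_eq_right h.1]
  have κmono : ∀ x y, x ≤ y → κ x ≤ κ y := fun x y h => by
    simp only [hκ]; gcongr
  have κlip : ∀ x y, x ≤ y → κ y - κ x ≤ y - x := fun x y h => by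
    simp only [hκ]
    rcases max_cases A (min y B) with h1 | h1 <;> rcases max_cases A (min x B) with h2 | h2 <;>
    rcases min_cases y B with h3 | h3 <;> rcases min_cases x B with h4 | h4 <;> linarith
  set H : ℝ → ℝ := fun y => H0 (κ y) + L * (y - κ y) with hH
  have Hc : Continuous H := by
    have : Continuous (fun y => H0 (κ y)) := cH0.comp_continuous κc κm
    exact this.add (continuous_const.mul (continuous_id.sub κc))
  have hAm : A ∈ Icc A B := left_mem_Icc.2 hAB.le
  have hBm : B ∈ Icc A B := right_mem_Icc.2 hAB.le
  have H0A : H0 A ≤ 0 := by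
    have := hpos A (hIS hAm)
    simp only [hH0]; rw [neg_nonpos]; positivity
  have H0B : 0 ≤ H0 B := by
    have := hpos B (hIS hBm)
    simp only [hH0]; rw [neg_nonneg]; exact div_nonpos_of_nonpos_of_nonneg hB (by positivity)
  set q : ℝ → ℝ := fun y => (f (κ y) ^ 2)⁻¹ with hq
  have fc : ContinuousOn f (Icc A B) := hf.continuousOn.mono hIS
  have qc : Continuous q := by
    have : Continuous (fun y => f (κ y)) := fc.comp_continuous κc κm
    refine Continuous.inv₀ (this.pow 2) (fun y => ?_)
    have := hpos _ (hIS (κm y)); positivity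
  obtain ⟨yM, hyM, hyMax⟩ := isCompact_Icc.exists_isMaxOn ⟨A, hAm⟩ fc
  obtain ⟨ym, hym, hyMin⟩ := isCompact_Icc.exists_isMinOn ⟨A, hAm⟩ fc
  have hfM := hpos _ (hIS hyM)
  have hfm := hpos _ (hIS hym)
  have hqb : ∀ y, (f yM ^ 2)⁻¹ ≤ q y ∧ q y ≤ (f ym ^ 2)⁻¹ := by
    intro y
    have h1 : f (κ y) ≤ f yM := hyMax (κm y)
    have h2 : f ym ≤ f (κ y) := hyMin (κm y)
    have h3 := hpos _ (hIS (κm y))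
    simp only [hq]
    constructor <;> gcongr
  intro τ0 x0 τ1 x1 hτ0 hx0 hτ1 hx1
  rw [mem_II_coe] at hτ0 hτ1
  obtain ⟨c, u, p, hc0, hu, hp, hu0, hu1, hur, hint⟩ := exist_core (A := A) (B := B) (L := L)
    (H := H) (q := q) hL0 Hc
    (by
      intro x y hxy
      have e1 := H0m (κm x) (κm y) (κmono x y hxy)
      have e2 := H0L (κm x) (κm y) (κmono x y hxy)
      have e3 := mul_le_mul_of_nonneg_left (κlip x y hxy) hL0
      simp only [hH] at *
      constructor <;> nlinarith)
    (by
      intro y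
      have e2 := H0L hAm (κm y) (κm y).1
      simp only [hH] at *
      nlinarith)
    (by
      intro y
      have e2 := H0L (κm y) hBm (κm y).2
      simp only [hH] at *
      nlinarith)
    qc (by positivity) hqb hτ0 hτ1 (abs_nonneg (x1 - x0))
  obtain ⟨e, he2, heint⟩ : ∃ e : ℝ, e ^ 2 = c ^ 2 ∧ e * ∫ t in (0:ℝ)..1, q (u t) = x1 - x0 := by
    rcases le_total 0 (x1 - x0) with h | h
    · exact ⟨c, rfl, by rw [hint, abs_of_nonneg h]⟩
    · exact ⟨-c, by ring, by rw [neg_mul, hint, abs_of_nonpos h]; ring⟩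
  have uc : Continuous u := continuous_iff_continuousAt.2 fun t => (hu t).continuousAt
  have quc : Continuous (fun t => q (u t)) := qc.comp uc
  set x : ℝ → ℝ := fun t => x0 + e * ∫ s in (0:ℝ)..t, q (u s) with hx
  have dx : ∀ t, HasDerivAt x (e * q (u t)) t := fun t =>
    ((intervalIntegral.integral_hasDerivAt_right (quc.intervalIntegrable _ _)
      (quc.stronglyMeasurableAtFilter _ _) quc.continuousAt).const_mul e).const_add x0
  have x0e : x 0 = x0 := by simp [hx]
  have x1e : x 1 = x1 := by simp only [hx]; rw [heint]; ring
  have huS : ∀ t ∈ Icc (0:ℝ) 1, u t ∈ Icc A B := fun t ht => Ioo_subset_Icc_self (hur t ht)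
  have hκu : ∀ t ∈ Icc (0:ℝ) 1, κ (u t) = u t := fun t ht => κid _ (huS t ht)
  have hH0u : ∀ t ∈ Icc (0:ℝ) 1, H (u t) = H0 (u t) := fun t ht => by
    simp only [hH]; rw [hκu t ht]; ring
  have hqu : ∀ t ∈ Icc (0:ℝ) 1, q (u t) = (f (u t) ^ 2)⁻¹ := fun t ht => by
    simp only [hq]; rw [hκu t ht]
  -- second derivative of x
  have dv : ∀ t ∈ Icc (0:ℝ) 1, HasDerivWithinAt (fun t => e * q (u t))
      (-(2 * (deriv f (u t) / f (u t)) * p t * (e * q (u t)))) (Icc 0 1) t := by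
    intro t ht
    have hfu := hpos _ (hIS (huS t ht))
    have h1 : HasDerivAt (fun t => f (u t)) (deriv f (u t) * p t) t :=
      (d0 _ (hIS (huS t ht))).comp t (hu t)
    have h2 := ((h1.pow 2).inv (by simp only [Pi.pow_apply]; positivity)).const_mul e
    have h3 : HasDerivWithinAt (fun t => e * (f (u t) ^ 2)⁻¹)
      (-(2 * (deriv f (u t) / f (u t)) * p t * (e * q (u t)))) (Icc 0 1) t := by
      refine (h2.congr_deriv ?_).hasDerivWithinAt
      rw [hqu t ht]
      simp only [Pi.pow_apply]
      field_simp
      try ring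
    exact h3.congr (fun s hs => by rw [hqu s hs]) (by rw [hqu t ht])
  have pc : ContinuousOn p (Icc 0 1) := fun t ht => (hp t ht).continuousAt.continuousWithinAt
  have fuc : ContinuousOn (fun t => f (u t)) (Icc 0 1) := fc.comp uc.continuousOn huS
  have f1uc : ContinuousOn (fun t => deriv f (u t)) (Icc 0 1) :=
    (hf1.continuousOn.mono hIS).comp uc.continuousOn huS
  have C1 := c2 one_pos (fun t _ => (hu t).hasDerivWithinAt) (fun t ht => (hp t ht).hasDerivWithinAt)
    (by fun_prop)
  have C2 := c2 one_pos (fun t _ => (dx t).hasDerivWithinAt) dv (by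
    have : ContinuousOn (fun t => deriv f (u t) / f (u t)) (Icc 0 1) :=
      f1uc.div fuc fun t ht => (hpos _ (hIS (huS t ht))).ne'
    fun_prop)
  refine ⟨u, x, 1, zero_le_one, ⟨?_, ?_, C1.1, C2.1, ?_, ?_⟩, hu0, x0e, hu1, x1e⟩
  · intro t ht; exact mem_II_coe.2 (hur t ht)
  · intro t ht
    have qpos : ∀ y, 0 ≤ q y := fun y => le_trans (by positivity) (hqb y).1
    rcases le_total 0 e with h | h
    · have := mono_of (a := 0) (b := 1) (fun t _ => (dx t).hasDerivWithinAt)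
        (fun t _ => mul_nonneg h (qpos _))
      refine hJ.out hx0 hx1 ⟨?_, ?_⟩
      · rw [← x0e]; exact this ⟨le_rfl, zero_le_one⟩ ht ht.1
      · rw [← x1e]; exact this ht ⟨zero_le_one, le_rfl⟩ ht.2
    · have := mono_of (a := 0) (b := 1) (fun t _ => (dx t).neg.hasDerivWithinAt)
        (fun t _ => by have := mul_nonneg (neg_nonneg.2 h) (qpos (u t)); linarith)
      refine hJ.out hx1 hx0 ⟨?_, ?_⟩
      · rw [← x1e]
        have := this ht ⟨zero_le_one, le_rfl⟩ ht.2
        simpa using this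
      · rw [← x0e]
        have := this ⟨le_rfl, zero_le_one⟩ ht ht.1
        simpa using this
  · intro t ht
    rw [(C1.2 t ht).2, (C2.2 t ht).1, hH0u t ht, hqu t ht, ← he2]
    have hfu := hpos _ (hIS (huS t ht))
    simp only [hH0]
    field_simp
  · intro t ht
    rw [(C2.2 t ht).2, (C2.2 t ht).1, (C1.2 t ht).1]

/-- necessity -/
lemma nec {A B : ℝ} (hAB : A < B) {f : ℝ → ℝ} {J : Set ℝ}
    {x0 x1 : ℝ} (hx0 : x0 ∈ J) (hx1 : x1 ∈ J) (hx : x0 < x1)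
    (hfd : ∀ τ ∈ Icc A B, HasDerivAt f (deriv f τ) τ) (hpos : ∀ τ ∈ Icc A B, 0 < f τ)
    (hanti : AntitoneOn (deriv f) (Icc A B))
    (hG : GeodConnected (A : EReal) (B : EReal) f J) : 0 ≤ deriv f A ∧ deriv f B ≤ 0 := by
  have hAm : A ∈ Icc A B := left_mem_Icc.2 hAB.le
  have hBm : B ∈ Icc A B := right_mem_Icc.2 hAB.le
  have fc : ContinuousOn f (Icc A B) := fun τ h => (hfd τ h).continuousAt.continuousWithinAt
  obtain ⟨yM, hyM, hyMax⟩ := isCompact_Icc.exists_isMaxOn ⟨A, hAm⟩ fc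
  obtain ⟨ym, hym, hyMin⟩ := isCompact_Icc.exists_isMinOn ⟨A, hAm⟩ fc
  have hfM := hpos _ hyM
  have hfm := hpos _ hym
  have core : ∀ s k : ℝ, 0 < k → (∀ τ ∈ Ioo A B, k ≤ s * deriv f τ) →
      ∃ η > 0, ∀ τ0 ∈ Ioo A B, ∃ τ ∈ Ioo A B, s * τ0 + η ≤ s * τ := by
    intro s k hk hs
    refine ⟨(k / f yM ^ 3) * (f ym ^ 2 * (x1 - x0)) ^ 2 / 8, ?_, ?_⟩
    · have : 0 < x1 - x0 := by linarith
      positivity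
    · intro τ0 hτ0
      obtain ⟨σ, x, t1, ht1, hg, e1, e2, e3, e4⟩ := hG τ0 x0 τ0 x1 (mem_II_coe.2 hτ0) hx0
        (mem_II_coe.2 hτ0) hx1
      have := nec_core (s := s) hk hfm (fun τ h => hfd τ (Ioo_subset_Icc_self h))
        (fun τ h => ⟨hyMin (Ioo_subset_Icc_self h), hyMax (Ioo_subset_Icc_self h)⟩) hs ht1 hg
        (by rw [e1, e3]) (by rw [e2, e4]; exact hx)
      rwa [e1, e2, e4] at this
  constructor
  · by_contra hcon
    push Not at hcon
    obtain ⟨η, hη, h⟩ := core (-1) (-deriv f A) (by linarith) (fun τ hτ => by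
      have := hanti hAm (Ioo_subset_Icc_self hτ) hτ.1.le
      linarith)
    obtain ⟨τ, hτ, h2⟩ := h (min ((A + B) / 2) (A + η))
      ⟨lt_min (by linarith) (by linarith), (min_le_left _ _).trans_lt (by linarith)⟩
    have := min_le_right ((A + B) / 2) (A + η)
    linarith [hτ.1]
  · by_contra hcon
    push Not at hcon
    obtain ⟨η, hη, h⟩ := core 1 (deriv f B) hcon (fun τ hτ => by
      have := hanti (Ioo_subset_Icc_self hτ) hBm hτ.2.le
      linarith)
    obtain ⟨τ, hτ, h2⟩ := h (max ((A + B) / 2) (B - η))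
      ⟨(by linarith : A < (A+B)/2).trans_le (le_max_left _ _), max_lt (by linarith) (by linarith)⟩
    have := le_max_right ((A + B) / 2) (B - η)
    linarith [hτ.2]

end GRWaux


/-- Suppose `f'' ≤ 0` on `(a,b)` and `a < â < b̂ < b`. The strip
`(â,b̂) × J` with the restricted metric is geodesically connected iff `f'(â) ≥ 0` and
`f'(b̂) ≤ 0`. -/
theorem strip_geodesically_connected_iff
    (aE bE : EReal) (hab : aE < bE) (f : ℝ → ℝ)
    (hf : ContDiffOn ℝ (⊤ : ℕ∞) f (II aE bE)) (hfpos : ∀ τ ∈ II aE bE, 0 < f τ)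
    (J : Set ℝ) (hJ : ∃ c d : EReal, c < d ∧ J = {x : ℝ | c < (x : EReal) ∧ (x : EReal) < d})
    (hconc : ∀ τ ∈ II aE bE, deriv (deriv f) τ ≤ 0)
    (aH bH : ℝ) (haH : aE < (aH : EReal)) (hHH : aH < bH) (hbH : (bH : EReal) < bE) :
    GeodConnected (aH : EReal) (bH : EReal) f J ↔ (0 ≤ deriv f aH ∧ deriv f bH ≤ 0) := by
  have hS := GRWaux.isOpen_II aE bE
  have hIS : Icc aH bH ⊆ II aE bE := fun t ht =>
    ⟨haH.trans_le (EReal.coe_le_coe_iff.2 ht.1), (EReal.coe_le_coe_iff.2 ht.2).trans_lt hbH⟩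
  obtain ⟨c, d, hcd, rfl⟩ := hJ
  constructor
  · intro hG
    obtain ⟨x0, h1, h2⟩ := EReal.lt_iff_exists_real_btwn.1 hcd
    obtain ⟨x1, h3, h4⟩ := EReal.lt_iff_exists_real_btwn.1 h2
    have hf1 : ContDiffOn ℝ (⊤ : ℕ∞) (deriv f) (II aE bE) := hf.deriv_of_isOpen hS (by simp)
    refine GRWaux.nec hHH (x0 := x0) (x1 := x1)
      (J := {x : ℝ | c < (x : EReal) ∧ (x : EReal) < d}) ⟨h1, h2⟩ ⟨h1.trans h3, h4⟩
      (EReal.coe_lt_coe_iff.1 h3) (fun τ h => ?_) (fun τ h => hfpos τ (hIS h)) ?_ hG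
    · exact ((hf.differentiableOn (by simp)).differentiableAt (hS.mem_nhds (hIS h))).hasDerivAt
    · have := GRWaux.mono_of (a := aH) (b := bH) (u := fun τ => - deriv f τ)
        (p := fun τ => - deriv (deriv f) τ) (fun τ h =>
          (((hf1.differentiableOn (by simp)).differentiableAt
            (hS.mem_nhds (hIS h))).hasDerivAt.neg).hasDerivWithinAt)
        (fun τ h => by linarith [hconc τ (hIS h)])
      intro x hx y hy hxy
      have := this hx hy hxy
      simpa using this
  · rintro ⟨hA, hB⟩
    refine GRWaux.suff hHH ⟨?_⟩ hS hIS hf hfpos hconc hA hB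
    intro x hx y hy z hz
    exact ⟨hx.1.trans_le (EReal.coe_le_coe_iff.2 hz.1), (EReal.coe_le_coe_iff.2 hz.2).trans_lt hy.2⟩
end
end
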